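/- arXiv:2302.09645 — 2 statements merged into one kernel-verified Lean document; each statement's English description precedes it below -/
import Mathlib

section
/- Let d ≥ 3 and α ∈ (0,1) ∪ (1,∞) be irrational, and let c ∈ (0, log d). Then the set of probability vectors λ ∈ ℝ^d with λ_i > 0, Σ λ_i = 1 and Σ_i λ_i^α = b^{c(1-α)} (i.e., classical Rényi entropy S_α(λ) = c) is not semialgebraic in ℝ^d on any open set it meets: for every open U ⊆ ℝ^d with nonempty intersection, the intersection is not semialgebraic. -/
/-- A set `S ⊆ ℝ^ι` is semialgebraic if it is a finite boolean combination of
polynomial equalities and strict polynomial inequalities with real coefficients. -/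
inductive IsSemialgebraic {ι : Type} [Fintype ι] : Set (ι → ℝ) → Prop
  | eq (p : MvPolynomial ι ℝ) : IsSemialgebraic {x | MvPolynomial.eval x p = 0}
  | lt (p : MvPolynomial ι ℝ) : IsSemialgebraic {x | 0 < MvPolynomial.eval x p}
  | union {s t : Set (ι → ℝ)} : IsSemialgebraic s → IsSemialgebraic t →
      IsSemialgebraic (s ∪ t)
  | inter {s t : Set (ι → ℝ)} : IsSemialgebraic s → IsSemialgebraic t →
      IsSemialgebraic (s ∩ t)
  | compl {s : Set (ι → ℝ)} : IsSemialgebraic s → IsSemialgebraic sᶜ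


section PowerPair
variable {F : Type*} [Field F] [Algebra ℝ F]

/-- `u` behaves like `x ^ α` for the derivation `D`: their logarithmic derivatives satisfy
`u' / u = α * (x' / x)`. -/
structure IsPowerPair (D : Derivation ℝ F F) (α : ℝ) (x u : F) : Prop where
  base_ne_zero : x ≠ 0
  power_ne_zero : u ≠ 0
  deriv_eq : x * D u = algebraMap ℝ F α * (u * D x)

variable {D : Derivation ℝ F F} {α : ℝ} {x y z u v w : F}

theorem IsPowerPair.div (h₁ : IsPowerPair D α x u) (h₂ : IsPowerPair D α y v) :
    IsPowerPair D α (x / y) (u / v) := by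
  obtain ⟨hx, hu, h⟩ := h₁
  obtain ⟨hy, hv, h'⟩ := h₂
  refine ⟨div_ne_zero hx hy, div_ne_zero hu hv, ?_⟩
  rw [Derivation.leibniz_div, Derivation.leibniz_div]
  simp only [smul_eq_mul]
  field_simp
  linear_combination v * y * h - u * x * h'

theorem algebraicIndependent_of_deriv_eq {f g : F} (δ : Derivation ℝ F F) (hf : f ≠ 0)
    (hg : g ≠ 0) (hα : Irrational α) (hδf : δ f = f) (hδg : δ g = algebraMap ℝ F α * g) :
    AlgebraicIndependent ℝ ![f, g] := by
  have hpow : ∀ (h : F) (c : ℝ) (n : ℕ), δ h = algebraMap ℝ F c * h →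
      δ (h ^ n) = algebraMap ℝ F (n * c) * h ^ n := by
    intro h c n hh
    rcases n with _ | n
    · simp
    · rw [Derivation.leibniz_pow, hh]
      simp
      ring
  have hli : LinearIndependent ℝ (fun m : Fin 2 →₀ ℕ ↦ f ^ m 0 * g ^ m 1) := by
    refine Module.End.eigenvectors_linearIndependent' (δ : F →ₗ[ℝ] F)
      (fun m : Fin 2 →₀ ℕ ↦ (m 0 : ℝ) + m 1 * α) ?_ _ ?_
    · intro m n hmn
      have hmn : (m 0 : ℝ) + m 1 * α = n 0 + n 1 * α := hmn
      have h1 : m 1 = n 1 := by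
        by_contra hne
        have hne' : (m 1 : ℤ) - n 1 ≠ 0 := by omega
        refine (hα.intCast_mul hne').ne_int ((n 0 : ℤ) - m 0) ?_
        push_cast
        linarith
      have h0 : m 0 = n 0 := by
        rw [h1] at hmn
        exact_mod_cast add_right_cancel hmn
      ext i
      fin_cases i <;> assumption
    · intro m
      refine Module.End.hasEigenvector_iff.2 ⟨Module.End.mem_eigenspace_iff.2 ?_, by positivity⟩
      have h1 := hpow f 1 (m 0) (by simpa using hδf)
      have h2 := hpow g α (m 1) hδg
      simp only [Derivation.coeFn_coe, Derivation.leibniz, h1, h2, smul_eq_mul, Algebra.smul_def]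
      simp
      ring
  refine (injective_iff_map_eq_zero _).2 fun P hP ↦ ?_
  rw [MvPolynomial.aeval_def, MvPolynomial.eval₂_eq'] at hP
  have h0 := linearIndependent_iff'.1 hli P.support (fun m ↦ P.coeff m)
    (by simpa [Fin.prod_univ_two, Algebra.smul_def] using hP)
  ext m
  by_cases hm : m ∈ P.support
  · simpa using h0 m hm
  · simpa using hm

theorem IsPowerPair.deriv_eq_zero (hα : Irrational α) (h : IsPowerPair D α x u)
    (hdep : ¬ AlgebraicIndependent ℝ ![x, u]) : D x = 0 := by
  obtain ⟨hx, hu, h⟩ := h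
  by_contra hD
  refine hdep (algebraicIndependent_of_deriv_eq ((x / D x) • D) hx hu hα ?_ ?_)
  · simp [hD]
  · simp only [Derivation.smul_apply, smul_eq_mul]
    field_simp
    linear_combination h

/-- A subfield of `F` stable under `D`, containing the constants, and of transcendence degree at
most one over `ℝ`. -/
structure IsThin (D : Derivation ℝ F F) (K : IntermediateField ℝ F) : Prop where
  deriv_mem : ∀ f ∈ K, D f ∈ K
  mem_of_deriv_eq_zero : ∀ f, D f = 0 → f ∈ K
  dependent : ∀ f ∈ K, ∀ g ∈ K, ¬ AlgebraicIndependent ℝ ![f, g]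

variable {K : IntermediateField ℝ F}

theorem IsThin.deriv_eq_zero (hK : IsThin D K) (hα : Irrational α) (h : IsPowerPair D α x u)
    (hx : x ∈ K) (hu : u ∈ K) : D x = 0 :=
  h.deriv_eq_zero hα (hK.dependent x hx u hu)

/-- If one base is constant, so are the others. -/
theorem IsThin.deriv_eq_zero_of_left (hK : IsThin D K) (hα : Irrational α)
    (hα0 : α ≠ 0) (hxu : IsPowerPair D α x u) (hyv : IsPowerPair D α y v)
    (hzw : IsPowerPair D α z w) (hy : y ∈ K) (hz : z ∈ K)
    (hs : D x + D y + D z = 0) (hp : D u + D v + D w = 0)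
    (hyz : y + z ≠ 0) (hDx : D x = 0) : D y = 0 := by
  have hα' : algebraMap ℝ F α ≠ 0 := by simpa using hα0
  obtain ⟨hx0, hu0, hxu⟩ := hxu
  have hDu : D u = 0 := by simpa [hDx, hx0] using hxu
  by_contra hDy
  have hq := hyv.div hzw
  obtain ⟨hy0, hv0, hyv⟩ := hyv
  obtain ⟨hz0, hw0, hzw⟩ := hzw
  have hDz : D z = - D y := by linear_combination hs - hDx
  have hDw : D w = - D v := by linear_combination hp - hDu
  rw [hDz, hDw] at hzw
  have h1 : v * z = w * y := by
    apply mul_left_cancel₀ (mul_ne_zero hα' hDy)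
    linear_combination -z * hyv - y * hzw
  have hvw : v / w ∈ K := by
    have : v / w = y / z := by field_simp; linear_combination h1
    rw [this]
    exact K.div_mem hy hz
  have h2 := hK.deriv_eq_zero hα hq (K.div_mem hy hz) hvw
  rw [Derivation.leibniz_div, hDz] at h2
  simp only [smul_eq_mul, mul_eq_zero, pow_eq_zero_iff, inv_eq_zero, hz0, ne_eq,
    OfNat.ofNat_ne_zero, not_false_eq_true, false_or] at h2
  have : D y * (y + z) = 0 := by linear_combination h2
  simp_all

/-- If the quotient of two powers is in the thin field, all bases are constant. -/
theorem IsThin.deriv_eq_zero_of_div_mem (hK : IsThin D K) (hα : Irrational α)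
    (hα0 : α ≠ 0) (hxu : IsPowerPair D α x u) (hyv : IsPowerPair D α y v)
    (hzw : IsPowerPair D α z w) (hx : x ∈ K) (hy : y ∈ K) (hz : z ∈ K)
    (hs : D x + D y + D z = 0) (hp : D u + D v + D w = 0) (hsum : x + y + z ≠ 0)
    (huv : u + v ≠ 0) (hmem : u / v ∈ K) : D x = 0 ∧ D y = 0 := by
  have hα' : algebraMap ℝ F α ≠ 0 := by simpa using hα0
  have hq := hxu.div hyv
  have hq' := hyv.div hzw
  obtain ⟨hx0, hu0, hxu⟩ := hxu
  obtain ⟨hy0, hv0, hyv⟩ := hyv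
  obtain ⟨hz0, hw0, hzw⟩ := hzw
  have h2 := hK.deriv_eq_zero hα hq (K.div_mem hx hy) hmem
  rw [Derivation.leibniz_div] at h2
  simp only [smul_eq_mul, mul_eq_zero, pow_eq_zero_iff, inv_eq_zero, hy0, ne_eq,
    OfNat.ofNat_ne_zero, not_false_eq_true, false_or] at h2
  suffices hDy : D y = 0 by
    refine ⟨?_, hDy⟩
    simpa [hDy, hy0] using h2
  by_contra hDy
  have hDu : y * D u = algebraMap ℝ F α * (u * D y) := by
    apply mul_left_cancel₀ hx0
    linear_combination y * hxu + algebraMap ℝ F α * u * h2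
  have h3 : (u + v) * z = w * (x + y) := by
    apply mul_left_cancel₀ (mul_ne_zero hα' hDy)
    linear_combination -z * hDu - z * hyv - y * hzw + y * z * hp
      - algebraMap ℝ F α * y * w * hs + algebraMap ℝ F α * w * h2
  have hvw : v / w ∈ K := by
    have hne : u / v + 1 ≠ 0 := by
      intro h
      field_simp at h
      exact huv (by simpa using h)
    have : v / w = ((x + y) / z) / (u / v + 1) := by
      rw [eq_div_iff hne]
      field_simp
      linear_combination h3
    rw [this]
    exact K.div_mem (K.div_mem (K.add_mem hx hy) hz) (K.add_mem hmem K.one_mem)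
  have h4 := hK.deriv_eq_zero hα hq' (K.div_mem hy hz) hvw
  rw [Derivation.leibniz_div] at h4
  simp only [smul_eq_mul, mul_eq_zero, pow_eq_zero_iff, inv_eq_zero, hz0, ne_eq,
    OfNat.ofNat_ne_zero, not_false_eq_true, false_or] at h4
  have hDz : D z = 0 := by
    apply mul_left_cancel₀ (mul_ne_zero hy0 hsum)
    linear_combination -x * h4 - y * h4 - z * h2 + y * z * hs
  rw [hDz] at h4
  simp_all

/-- Three thin functions with constant sum whose powers have constant sum are constant. -/
theorem IsThin.deriv_eq_zero_of_sum (hK : IsThin D K) (hα : Irrational α)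
    (hα0 : α ≠ 0) (hxu : IsPowerPair D α x u) (hyv : IsPowerPair D α y v)
    (hzw : IsPowerPair D α z w) (hx : x ∈ K) (hy : y ∈ K) (hz : z ∈ K)
    (hs : D x + D y + D z = 0) (hp : D u + D v + D w = 0) (hsum : x + y + z ≠ 0)
    (hxz : x + z ≠ 0) (hyz : y + z ≠ 0)
    (huv : u + v ≠ 0) (huw : u + w ≠ 0) : D x = 0 ∧ D y = 0 := by
  have h₁ := hxu
  have h₂ := hyv
  have h₃ := hzw
  obtain ⟨hx0, hu0, hxu⟩ := hxu
  obtain ⟨hy0, hv0, hyv⟩ := hyv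
  obtain ⟨hz0, hw0, hzw⟩ := hzw
  have hlog : ∀ f ∈ K, algebraMap ℝ F α * D f / f ∈ K := fun f hf ↦
    K.div_mem (K.mul_mem (K.algebraMap_mem α) (hK.deriv_mem f hf)) hf
  obtain ⟨a, ha⟩ : ∃ a, a = algebraMap ℝ F α * D x / x := ⟨_, rfl⟩
  obtain ⟨b, hb⟩ : ∃ b, b = algebraMap ℝ F α * D y / y := ⟨_, rfl⟩
  obtain ⟨c, hc⟩ : ∃ c, c = algebraMap ℝ F α * D z / z := ⟨_, rfl⟩
  have haK : a ∈ K := ha ▸ hlog x hx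
  have hbK : b ∈ K := hb ▸ hlog y hy
  have hcK : c ∈ K := hc ▸ hlog z hz
  have hDu : D u = a * u := by rw [ha]; field_simp; linear_combination hxu
  have hDv : D v = b * v := by rw [hb]; field_simp; linear_combination hyv
  have hDw : D w = c * w := by rw [hc]; field_simp; linear_combination hzw
  rw [hDu, hDv, hDw] at hp
  have hp' := congrArg D hp
  simp only [map_add, Derivation.leibniz, smul_eq_mul, hDu, hDv, hDw, map_zero] at hp'
  have hp₀ : D u + D v + D w = 0 := by rw [hDu, hDv, hDw, hp]
  obtain hΔ | hΔ := ne_or_eq (a * (D b + b ^ 2) - b * (D a + a ^ 2)) 0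
  · have huw' : u / w ∈ K := by
      have : u / w = (b * (D c + c ^ 2) - c * (D b + b ^ 2)) /
          (a * (D b + b ^ 2) - b * (D a + a ^ 2)) := by
        rw [div_eq_div_iff hw0 hΔ]
        linear_combination (D b + b ^ 2) * hp - b * hp'
      rw [this]
      have := hK.deriv_mem
      exact K.div_mem
        (K.sub_mem (K.mul_mem hbK (K.add_mem (this c hcK) (pow_mem hcK 2)))
          (K.mul_mem hcK (K.add_mem (this b hbK) (pow_mem hbK 2))))
        (K.sub_mem (K.mul_mem haK (K.add_mem (this b hbK) (pow_mem hbK 2)))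
          (K.mul_mem hbK (K.add_mem (this a haK) (pow_mem haK 2))))
    obtain ⟨hDx, hDz⟩ := hK.deriv_eq_zero_of_div_mem hα hα0 h₁ h₃ h₂ hx hz hy
      (by linear_combination hs) (by linear_combination hp₀) (by convert hsum using 1; ring)
      huw huw'
    refine ⟨hDx, ?_⟩
    rwa [hDx, hDz, zero_add, add_zero] at hs
  obtain ha0 | ha0 := eq_or_ne a 0
  · have hDx : D x = 0 := by
      rw [ha0, eq_comm, div_eq_zero_iff] at ha
      simp_all
    exact ⟨hDx, hK.deriv_eq_zero_of_left hα hα0 h₁ h₂ h₃ hy hz hs hp₀ hyz hDx⟩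
  obtain hb0 | hb0 := eq_or_ne b 0
  · have hDy : D y = 0 := by
      rw [hb0, eq_comm, div_eq_zero_iff] at hb
      simp_all
    exact ⟨hK.deriv_eq_zero_of_left hα hα0 h₂ h₁ h₃ hx hz (by linear_combination hs)
      (by linear_combination hp₀) hxz hDy, hDy⟩
  have hg : (a * u) / (b * v) ∈ K := by
    refine hK.mem_of_deriv_eq_zero _ ?_
    rw [Derivation.leibniz_div]
    simp only [Derivation.leibniz, smul_eq_mul, hDu, hDv]
    linear_combination -((b * v)⁻¹ ^ 2 * u * v) * hΔ
  refine hK.deriv_eq_zero_of_div_mem hα hα0 h₁ h₂ h₃ hx hy hz hs hp₀ hsum huv ?_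
  have : u / v = b / a * ((a * u) / (b * v)) := by field_simp
  rw [this]
  exact K.mul_mem (K.div_mem hbK haK) hg

/-- The elements algebraic over `ℝ(t)`. -/
noncomputable def algebraicOver (t : F) : IntermediateField ℝ F :=
  (algebraicClosure (IntermediateField.adjoin ℝ {t}) F).restrictScalars ℝ

theorem mem_algebraicOver {t f : F} :
    f ∈ algebraicOver t ↔ IsAlgebraic (IntermediateField.adjoin ℝ {t}) f := by
  simp [algebraicOver, mem_algebraicClosure_iff]

theorem Derivation.exists_aeval_eq (D : Derivation ℝ F F) (L : IntermediateField ℝ F)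
    (hL : ∀ f ∈ L, D f ∈ L) (f : F) (p : Polynomial L) :
    ∃ q : Polynomial L, D (Polynomial.aeval f p) =
      Polynomial.aeval f q + Polynomial.aeval f (Polynomial.derivative p) * D f := by
  induction p using Polynomial.induction_on' with
  | add p₁ p₂ h₁ h₂ =>
    obtain ⟨q₁, h₁⟩ := h₁
    obtain ⟨q₂, h₂⟩ := h₂
    refine ⟨q₁ + q₂, ?_⟩
    simp only [map_add, h₁, h₂]
    ring
  | monomial n c =>
    refine ⟨Polynomial.monomial n ⟨D c, hL c c.2⟩, ?_⟩
    have hc : ∀ c : L, algebraMap L F c = c := fun _ ↦ rfl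
    simp only [Polynomial.aeval_monomial, Polynomial.derivative_monomial, Derivation.leibniz,
      Derivation.leibniz_pow, smul_eq_mul, hc, nsmul_eq_mul]
    push_cast
    ring

open scoped IntermediateField.algebraAdjoinAdjoin in
theorem isThin_algebraicOver {t : F} (ht : D t = 1)
    (hconst : ∀ f, D f = 0 → ∃ r, f = algebraMap ℝ F r) : IsThin D (algebraicOver t) := by
  set L := IntermediateField.adjoin ℝ {t} with hLdef
  have hL : ∀ f ∈ L, D f ∈ L := by
    intro f hf
    induction hf using IntermediateField.adjoin_induction with
    | mem x hx =>
      rw [Set.mem_singleton_iff.1 hx, ht]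
      exact L.one_mem
    | algebraMap r => simp
    | add x y _ _ hx hy => simpa using L.add_mem hx hy
    | inv x hx h =>
      rw [Derivation.leibniz_inv]
      exact L.mul_mem (L.neg_mem (pow_mem (L.inv_mem hx) 2)) h
    | mul x y hx hy hx' hy' =>
      rw [Derivation.leibniz]
      exact L.add_mem (L.mul_mem hx hy') (L.mul_mem hy hx')
  refine ⟨fun f hf ↦ ?_, fun f hf ↦ ?_, fun f hf g hg hind ↦ ?_⟩
  · have hint : IsIntegral L f := (mem_algebraicOver.1 hf).isIntegral
    obtain ⟨q, hq⟩ := D.exists_aeval_eq L hL f (minpoly L f)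
    rw [minpoly.aeval, map_zero] at hq
    have hne : Polynomial.aeval f (Polynomial.derivative (minpoly L f)) ≠ 0 :=
      (minpoly.irreducible hint).separable.aeval_derivative_ne_zero (minpoly.aeval L f)
    have haeval : ∀ p : Polynomial L, Polynomial.aeval f p ∈ algebraicOver t := fun p ↦
      (Algebra.adjoin_le (S := (algebraicClosure L F).toSubalgebra)
        (Set.singleton_subset_iff.2 hf)) (Polynomial.aeval_mem_adjoin_singleton L f)
    have : D f = -(Polynomial.aeval f q) /
        Polynomial.aeval f (Polynomial.derivative (minpoly L f)) := by
      rw [eq_div_iff hne]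
      linear_combination -hq
    rw [this]
    exact div_mem (neg_mem (haeval _)) (haeval _)
  · obtain ⟨r, rfl⟩ := hconst f hf
    exact (algebraicOver t).algebraMap_mem r
  · have halg : ∀ h ∈ algebraicOver t, h ∈ (AlgebraicIndependent.matroid ℝ F).closure {t} := by
      intro h hh
      rw [AlgebraicIndependent.matroid_closure_eq, SetLike.mem_coe, Subalgebra.mem_algebraicClosure]
      exact (IsFractionRing.isAlgebraic_iff (Algebra.adjoin ℝ {t}) L F).2 (mem_algebraicOver.1 hh)
    have h1 : (AlgebraicIndependent.matroid ℝ F).Indep (Set.range ![f, g]) :=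
      AlgebraicIndependent.matroid_indep_iff.2 hind.to_subtype_range
    have h2 : Set.range ![f, g] ⊆ (AlgebraicIndependent.matroid ℝ F).closure {t} := by
      rintro _ ⟨i, rfl⟩
      fin_cases i
      · exact halg f hf
      · exact halg g hg
    have h3 := h1.encard_le_eRk_of_subset h2
    have h4 := (AlgebraicIndependent.matroid ℝ F).eRk_singleton_le t
    rw [Matroid.eRk_closure_eq] at h3
    have h5 := h3.trans h4
    rw [← Set.image_univ, hind.injective.encard_image] at h5
    simp at h5

theorem Derivation.eq_zero_of_isAlgebraic (D : Derivation ℝ F F) {f : F}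
    (hf : IsAlgebraic ℝ f) : D f = 0 := by
  have h := congrArg D (minpoly.aeval ℝ f)
  rw [Derivation.map_aeval, map_zero, smul_eq_mul, mul_eq_zero] at h
  exact h.resolve_left ((minpoly.irreducible hf.isIntegral).separable.aeval_derivative_ne_zero
    (minpoly.aeval ℝ f))

open scoped IntermediateField.algebraAdjoinAdjoin in
theorem mem_algebraicOver_of_not_algebraicIndependent {f t : F} (ht : D t ≠ 0)
    (h : ¬ AlgebraicIndependent ℝ ![f, t]) : f ∈ algebraicOver t := by
  suffices hcl : f ∈ (AlgebraicIndependent.matroid ℝ F).closure {t} by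
    rw [AlgebraicIndependent.matroid_closure_eq, SetLike.mem_coe,
      Subalgebra.mem_algebraicClosure] at hcl
    exact mem_algebraicOver.2 ((IsFractionRing.isAlgebraic_iff (Algebra.adjoin ℝ {t})
      (IntermediateField.adjoin ℝ {t}) F).1 hcl)
  have hind : (AlgebraicIndependent.matroid ℝ F).Indep {t} := by
    rw [AlgebraicIndependent.matroid_indep_iff, AlgebraicIndepOn,
      algebraicIndependent_singleton_iff (⟨t, rfl⟩ : ({t} : Set F))]
    exact fun halg ↦ ht (D.eq_zero_of_isAlgebraic halg)
  by_cases hft : f = t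
  · exact (AlgebraicIndependent.matroid ℝ F).mem_closure_of_mem hft
  rw [hind.mem_closure_iff]
  refine .inl ⟨fun hi ↦ h ?_, by simp⟩
  have hinj : Function.Injective ![f, t] := by
    intro i j hij
    fin_cases i <;> fin_cases j <;> simp_all [eq_comm]
  have hrange : Set.range ![f, t] = {f, t} := by simp [Set.pair_comm]
  rw [← hrange] at hi
  exact (algebraicIndependent_subtype_range hinj).1 hi

end PowerPair

open Filter Topology

section GermField

/-- Germs at `t₀` from the right of real functions meromorphic at `t₀`. -/
def MeromorphicGerm (t₀ : ℝ) : Subring (Germ (𝓝[>] t₀) ℝ) where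
  carrier := {G | ∃ f : ℝ → ℝ, MeromorphicAt f t₀ ∧ (f : Germ (𝓝[>] t₀) ℝ) = G}
  mul_mem' := by
    rintro _ _ ⟨f, hf, rfl⟩ ⟨g, hg, rfl⟩
    exact ⟨f * g, hf.mul hg, rfl⟩
  add_mem' := by
    rintro _ _ ⟨f, hf, rfl⟩ ⟨g, hg, rfl⟩
    exact ⟨f + g, hf.add hg, rfl⟩
  one_mem' := ⟨1, .const 1 t₀, rfl⟩
  zero_mem' := ⟨0, .const 0 t₀, rfl⟩
  neg_mem' := by
    rintro _ ⟨f, hf, rfl⟩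
    exact ⟨-f, hf.neg, rfl⟩

namespace MeromorphicGerm
variable {t₀ : ℝ}

/-- The germ of a meromorphic function. -/
def of (f : ℝ → ℝ) (hf : MeromorphicAt f t₀) : MeromorphicGerm t₀ := ⟨f, f, hf, rfl⟩

theorem exists_of (G : MeromorphicGerm t₀) : ∃ f hf, G = of f hf := by
  obtain ⟨_, f, hf, rfl⟩ := G
  exact ⟨f, hf, rfl⟩

theorem of_eq_iff {f g : ℝ → ℝ} {hf : MeromorphicAt f t₀} {hg : MeromorphicAt g t₀} :
    of f hf = of g hg ↔ f =ᶠ[𝓝[>] t₀] g :=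
  Subtype.ext_iff.trans Germ.coe_eq

theorem isField : IsField (MeromorphicGerm t₀) where
  exists_pair_ne := by
    refine ⟨of (fun _ ↦ 0) (.const 0 t₀), of (fun _ ↦ 1) (.const 1 t₀), ?_⟩
    rw [Ne, of_eq_iff]
    intro h
    obtain ⟨x, hx⟩ := h.exists
    exact zero_ne_one hx
  mul_comm := mul_comm
  mul_inv_cancel := by
    intro G hG
    obtain ⟨f, hf, rfl⟩ := exists_of G
    refine ⟨of f⁻¹ hf.inv, ?_⟩
    have hle : 𝓝[>] t₀ ≤ 𝓝[≠] t₀ := nhdsWithin_mono _ fun x hx ↦ ne_of_gt hx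
    obtain h | h := hf.eventually_eq_zero_or_eventually_ne_zero
    · exact absurd ((of_eq_iff (hg := .const 0 t₀)).2 (h.filter_mono hle)) hG
    · refine (of_eq_iff (hf := hf.mul hf.inv) (hg := .const 1 t₀)).2 ?_
      filter_upwards [h.filter_mono hle] with x hx
      exact mul_inv_cancel₀ hx

noncomputable instance : Field (MeromorphicGerm t₀) := isField.toField

/-- Constant functions as germs. -/
noncomputable def constHom (t₀ : ℝ) : ℝ →+* MeromorphicGerm t₀ where
  toFun r := of (fun _ ↦ r) (.const r t₀)
  map_one' := rfl
  map_zero' := rfl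
  map_mul' _ _ := rfl
  map_add' _ _ := rfl

noncomputable instance : Algebra ℝ (MeromorphicGerm t₀) := (constHom t₀).toAlgebra

theorem algebraMap_eq (r : ℝ) : algebraMap ℝ (MeromorphicGerm t₀) r =
    of (fun _ ↦ r) (.const r t₀) := rfl

theorem of_add {f g : ℝ → ℝ} (hf : MeromorphicAt f t₀) (hg : MeromorphicAt g t₀) :
    of f hf + of g hg = of (fun t ↦ f t + g t) (hf.add hg) := rfl

theorem of_mul {f g : ℝ → ℝ} (hf : MeromorphicAt f t₀) (hg : MeromorphicAt g t₀) :
    of f hf * of g hg = of (fun t ↦ f t * g t) (hf.mul hg) := rfl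

theorem of_ne_zero {f : ℝ → ℝ} (hf : MeromorphicAt f t₀) (h : ∀ᶠ t in 𝓝[>] t₀, f t ≠ 0) :
    of f hf ≠ 0 := by
  intro h0
  obtain ⟨x, hx, hx'⟩ := (h.and ((of_eq_iff (hg := .const 0 t₀)).1 h0)).exists
  exact hx hx'

theorem eventually_differentiableAt {f : ℝ → ℝ} (hf : MeromorphicAt f t₀) :
    ∀ᶠ t in 𝓝[>] t₀, DifferentiableAt ℝ f t := by
  have hle : 𝓝[>] t₀ ≤ 𝓝[≠] t₀ := nhdsWithin_mono _ fun x hx ↦ ne_of_gt hx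
  filter_upwards [hf.eventually_analyticAt.filter_mono hle] with t ht
  exact ht.differentiableAt

theorem eventuallyEq_deriv {f g : ℝ → ℝ} (h : f =ᶠ[𝓝[>] t₀] g) :
    deriv f =ᶠ[𝓝[>] t₀] deriv g := by
  filter_upwards [eventually_eventually_nhdsWithin.2 h, self_mem_nhdsWithin] with t ht ht0
  rw [IsOpen.nhdsWithin_eq isOpen_Ioi ht0] at ht
  exact EventuallyEq.deriv_eq ht

/-- The derivative of a germ. -/
noncomputable def derivFun (G : MeromorphicGerm t₀) : MeromorphicGerm t₀ :=
  of (deriv (exists_of G).choose) (exists_of G).choose_spec.choose.deriv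

theorem derivFun_of {f : ℝ → ℝ} (hf : MeromorphicAt f t₀) :
    derivFun (of f hf) = of (deriv f) hf.deriv := by
  have h := (exists_of (of f hf)).choose_spec.choose_spec
  rw [of_eq_iff] at h
  exact of_eq_iff.2 (eventuallyEq_deriv h).symm

/-- Differentiation of germs. -/
noncomputable def derivation (t₀ : ℝ) : Derivation ℝ (MeromorphicGerm t₀) (MeromorphicGerm t₀) :=
  Derivation.mk'
    { toFun := derivFun
      map_add' := by
        intro G H
        obtain ⟨f, hf, rfl⟩ := exists_of G
        obtain ⟨g, hg, rfl⟩ := exists_of H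
        rw [of_add, derivFun_of, derivFun_of, derivFun_of, of_add, of_eq_iff]
        filter_upwards [eventually_differentiableAt hf, eventually_differentiableAt hg]
          with t hft hgt
        exact deriv_fun_add hft hgt
      map_smul' := by
        intro r G
        obtain ⟨f, hf, rfl⟩ := exists_of G
        rw [Algebra.smul_def, Algebra.smul_def, algebraMap_eq, of_mul, derivFun_of, derivFun_of,
          RingHom.id_apply, algebraMap_eq, of_mul, of_eq_iff]
        filter_upwards [eventually_differentiableAt hf] with t hft
        exact deriv_const_mul r hft }
    (by
      intro G H
      obtain ⟨f, hf, rfl⟩ := exists_of G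
      obtain ⟨g, hg, rfl⟩ := exists_of H
      simp only [LinearMap.coe_mk, AddHom.coe_mk, smul_eq_mul]
      rw [of_mul, derivFun_of, derivFun_of, derivFun_of, of_mul, of_mul, of_add, of_eq_iff]
      filter_upwards [eventually_differentiableAt hf, eventually_differentiableAt hg]
        with t hft hgt
      rw [deriv_fun_mul hft hgt]
      ring)

theorem derivation_of {f : ℝ → ℝ} (hf : MeromorphicAt f t₀) :
    derivation t₀ (of f hf) = of (deriv f) hf.deriv := derivFun_of hf

theorem exists_eq_algebraMap (G : MeromorphicGerm t₀) (hG : derivation t₀ G = 0) :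
    ∃ r, G = algebraMap ℝ _ r := by
  obtain ⟨f, hf, rfl⟩ := exists_of G
  rw [derivation_of] at hG
  have hz := (of_eq_iff (hg := .const 0 t₀)).1 hG
  obtain ⟨ε, hε, h⟩ := mem_nhdsGT_iff_exists_Ioo_subset.1 (hz.and (eventually_differentiableAt hf))
  have hε : t₀ < ε := hε
  obtain ⟨s, hs⟩ := exists_between hε
  refine ⟨f s, ?_⟩
  rw [algebraMap_eq, of_eq_iff]
  filter_upwards [Ioo_mem_nhdsGT hε] with t ht
  exact isOpen_Ioo.is_const_of_deriv_eq_zero isPreconnected_Ioo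
    (fun x hx ↦ (h hx).2.differentiableWithinAt) (fun x hx ↦ (h hx).1) ht hs

end MeromorphicGerm
end GermField

theorem IsSemialgebraic.exists_eventually_mem_iff {ι κ : Type} [Fintype ι] [Fintype κ]
    {S : Set (ι → ℝ)} (hS : IsSemialgebraic S) (q : ι → MvPolynomial κ ℝ) :
    ∃ P : MvPolynomial κ ℝ, P ≠ 0 ∧ ∀ v, MvPolynomial.eval v P ≠ 0 → ∀ᶠ v' in 𝓝 v,
      ((fun i ↦ MvPolynomial.eval v' (q i)) ∈ S ↔ (fun i ↦ MvPolynomial.eval v (q i)) ∈ S) := by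
  have heval : ∀ (v : κ → ℝ) (p : MvPolynomial ι ℝ),
      MvPolynomial.eval (fun i ↦ MvPolynomial.eval v (q i)) p =
        MvPolynomial.eval v (MvPolynomial.bind₁ q p) := fun v p ↦
    (MvPolynomial.eval₂Hom_bind₁ (RingHom.id ℝ) v q p).symm
  induction hS with
  | eq p =>
    by_cases hp : MvPolynomial.bind₁ q p = 0
    · exact ⟨1, one_ne_zero, fun v _ ↦ .of_forall fun v' ↦ by simp [heval, hp]⟩
    · refine ⟨_, hp, fun v hv ↦ ?_⟩
      filter_upwards [(MvPolynomial.continuous_eval _).continuousAt.eventually_ne hv] with v' hv'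
      simp [heval, hv, hv']
  | lt p =>
    by_cases hp : MvPolynomial.bind₁ q p = 0
    · exact ⟨1, one_ne_zero, fun v _ ↦ .of_forall fun v' ↦ by simp [heval, hp]⟩
    · refine ⟨_, hp, fun v hv ↦ ?_⟩
      have hc := (MvPolynomial.continuous_eval (MvPolynomial.bind₁ q p)).continuousAt (x := v)
      obtain h | h := hv.lt_or_gt
      · filter_upwards [hc.eventually_lt_const h] with v' hv'
        simp [heval, h.not_gt, hv'.not_gt]
      · filter_upwards [hc.eventually_const_lt h] with v' hv'
        simp [heval, h, hv']
  | union _ _ hs ht =>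
    obtain ⟨P, hP, h⟩ := hs
    obtain ⟨Q, hQ, h'⟩ := ht
    refine ⟨P * Q, mul_ne_zero hP hQ, fun v hv ↦ ?_⟩
    rw [map_mul] at hv
    filter_upwards [h v (left_ne_zero_of_mul hv), h' v (right_ne_zero_of_mul hv)] with v' h₁ h₂
    rw [Set.mem_union, Set.mem_union, h₁, h₂]
  | inter _ _ hs ht =>
    obtain ⟨P, hP, h⟩ := hs
    obtain ⟨Q, hQ, h'⟩ := ht
    refine ⟨P * Q, mul_ne_zero hP hQ, fun v hv ↦ ?_⟩
    rw [map_mul] at hv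
    filter_upwards [h v (left_ne_zero_of_mul hv), h' v (right_ne_zero_of_mul hv)] with v' h₁ h₂
    rw [Set.mem_inter_iff, Set.mem_inter_iff, h₁, h₂]
  | compl _ hs =>
    obtain ⟨P, hP, h⟩ := hs
    refine ⟨P, hP, fun v hv ↦ ?_⟩
    filter_upwards [h v hv] with v' h₁
    rw [Set.mem_compl_iff, Set.mem_compl_iff, h₁]

theorem hasDerivAt_rpow_add_rpow_sub {α s r : ℝ} (c : ℝ) (hs : 0 < s) (hr : 0 < r - s) :
    HasDerivAt (fun s ↦ s ^ α + (r - s) ^ α + c) (α * (s ^ (α - 1) - (r - s) ^ (α - 1))) s := by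
  have h1 := Real.hasDerivAt_rpow_const (p := α) (.inl hs.ne')
  have h2 := ((hasDerivAt_id s).const_sub r).rpow_const (p := α) (.inl hr.ne')
  refine ((h1.add h2).add_const c).congr_deriv ?_
  rw [id]
  ring

theorem rpow_sub_rpow_ne_zero {α x y : ℝ} (hα0 : α ≠ 0) (hα1 : α ≠ 1) (hx : 0 < x) (hy : 0 < y)
    (hxy : x ≠ y) : α * (x ^ (α - 1) - y ^ (α - 1)) ≠ 0 := by
  refine mul_ne_zero hα0 (sub_ne_zero.2 fun h ↦ hxy ?_)
  exact (Real.rpow_left_inj hx.le hy.le (sub_ne_zero.2 hα1)).1 h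

open scoped ContDiff in
/-- Near a point with `x₀ ≠ y₀`, the curve `x + y + t = γ`, `x ^ α + y ^ α + t ^ α = β` is
analytically parametrized by `t`. -/
theorem exists_analyticAt_rpow_curve {α x₀ y₀ z₀ : ℝ} (hα0 : α ≠ 0) (hα1 : α ≠ 1) (hx : 0 < x₀)
    (hy : 0 < y₀) (hz : 0 < z₀) (hxy : x₀ ≠ y₀) :
    ∃ X : ℝ → ℝ, AnalyticAt ℝ X z₀ ∧ X z₀ = x₀ ∧ ∀ᶠ t in 𝓝 z₀,
      X t ^ α + (x₀ + y₀ + z₀ - t - X t) ^ α + t ^ α = x₀ ^ α + y₀ ^ α + z₀ ^ α := by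
  set f : ℝ × ℝ → ℝ := fun p ↦ p.2 ^ α + (x₀ + y₀ + z₀ - p.1 - p.2) ^ α + p.1 ^ α with hf
  have hy' : x₀ + y₀ + z₀ - z₀ - x₀ = y₀ := by ring
  have cdf : ContDiffAt ℝ ω f (z₀, x₀) := by
    refine ((contDiffAt_snd.rpow_const_of_ne hx.ne').add
      (ContDiffAt.rpow_const_of_ne ?_ ?_)).add (contDiffAt_fst.rpow_const_of_ne hz.ne')
    · fun_prop
    · simpa [hy'] using hy.ne'
  have hd : HasDerivAt (fun s ↦ f (z₀, s)) (α * (x₀ ^ (α - 1) - y₀ ^ (α - 1))) x₀ := by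
    have := hasDerivAt_rpow_add_rpow_sub (α := α) (r := x₀ + y₀ + z₀ - z₀) (z₀ ^ α) hx
      (by rwa [hy'])
    rwa [hy'] at this
  have hd' : HasFDerivAt (fun s ↦ f (z₀, s)) (fderiv ℝ f (z₀, x₀) ∘L .inr ℝ ℝ ℝ) x₀ :=
    (cdf.differentiableAt (by simp)).hasFDerivAt.comp x₀ (hasFDerivAt_prodMk_right z₀ x₀)
  have hinv : (fderiv ℝ f (z₀, x₀) ∘L .inr ℝ ℝ ℝ).IsInvertible := by
    rw [hd'.unique hd.hasFDerivAt]
    refine ⟨ContinuousLinearEquiv.unitsEquivAut ℝ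
      (Units.mk0 _ (rpow_sub_rpow_ne_zero hα0 hα1 hx hy hxy)), ?_⟩
    ext
    simp
  refine ⟨cdf.implicitFunction (by simp) hinv,
    (cdf.contDiffAt_implicitFunction (by simp) hinv).analyticAt,
    cdf.implicitFunction_apply_self (by simp) hinv, ?_⟩
  filter_upwards [cdf.eventually_apply_implicitFunction (by simp) hinv] with t ht
  simpa [hf, hy'] using ht

/-- The vector `l` with entries `i`, `j`, `k` replaced by `a`, `b`, `c`. -/
def replaceThree {ι A : Type*} [DecidableEq ι] (l : ι → A) (i j k : ι) (a b c : A) : ι → A :=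
  fun m ↦ if m = i then a else if m = j then b else if m = k then c else l m

theorem sum_replaceThree {ι A : Type*} [Fintype ι] [DecidableEq ι] (l : ι → A) {i j k : ι}
    (hij : i ≠ j) (hik : i ≠ k) (hjk : j ≠ k) (h : A → ℝ) (a b c : A) :
    ∑ m, h (replaceThree l i j k a b c m) =
      ∑ m, h (l m) + (h a + h b + h c) - (h (l i) + h (l j) + h (l k)) := by
  have hsum : ∀ g : ι → A, ∑ m, h (g m) =
      h (g i) + h (g j) + h (g k) + ∑ m ∈ {i, j, k}ᶜ, h (g m) := by
    intro g
    rw [← Finset.sum_add_sum_compl {i, j, k}, Finset.sum_insert (by simp [hij, hik]),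
      Finset.sum_pair hjk]
    ring
  have hc : ∑ m ∈ {i, j, k}ᶜ, h (replaceThree l i j k a b c m) = ∑ m ∈ {i, j, k}ᶜ, h (l m) := by
    refine Finset.sum_congr rfl fun m hm ↦ ?_
    simp only [Finset.mem_compl, Finset.mem_insert, Finset.mem_singleton, not_or] at hm
    simp [replaceThree, hm]
  rw [hsum, hsum l, hc]
  simp [replaceThree, hij.symm, hik.symm, hjk.symm]
  ring

namespace MeromorphicGerm

variable {t₀ : ℝ}

theorem isPowerPair_of {f : ℝ → ℝ} (α : ℝ) (hf : AnalyticAt ℝ f t₀) (hpos : 0 < f t₀) :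
    ∃ h : MeromorphicAt (fun t ↦ f t ^ α) t₀,
      IsPowerPair (derivation t₀) α (of f hf.meromorphicAt) (of (fun t ↦ f t ^ α) h) := by
  have hev : ∀ᶠ t in 𝓝[>] t₀, 0 < f t :=
    (hf.continuousAt.eventually_const_lt hpos).filter_mono nhdsWithin_le_nhds
  have ha : AnalyticAt ℝ (fun t ↦ f t ^ α) t₀ :=
    (hf.contDiffAt.rpow_const_of_ne hpos.ne').analyticAt
  refine ⟨ha.meromorphicAt, of_ne_zero _ (hev.mono fun t ht ↦ ht.ne'),
    of_ne_zero _ (hev.mono fun t ht ↦ (Real.rpow_pos_of_pos ht α).ne'), ?_⟩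
  rw [derivation_of, derivation_of, algebraMap_eq, of_mul, of_mul, of_mul, of_eq_iff]
  filter_upwards [hev, eventually_differentiableAt hf.meromorphicAt] with t ht hd
  rw [(hd.hasDerivAt.rpow_const (.inl ht.ne')).deriv, Real.rpow_sub_one ht.ne']
  field_simp

theorem aeval_of {X Y : ℝ → ℝ} (hX : MeromorphicAt X t₀) (hY : MeromorphicAt Y t₀)
    (P : MvPolynomial (Fin 2) ℝ) :
    ∃ h, MvPolynomial.aeval ![of X hX, of Y hY] P =
      of (fun t ↦ MvPolynomial.eval ![X t, Y t] P) h := by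
  induction P using MvPolynomial.induction_on with
  | C a =>
    simp only [MvPolynomial.eval_C, MvPolynomial.algHom_C]
    exact ⟨.const a t₀, rfl⟩
  | add p q hp hq =>
    obtain ⟨h, hp⟩ := hp
    obtain ⟨h', hq⟩ := hq
    simp only [map_add, hp, hq]
    exact ⟨h.add h', rfl⟩
  | mul_X p i hp =>
    obtain ⟨h, hp⟩ := hp
    simp only [map_mul, hp, MvPolynomial.aeval_X, MvPolynomial.eval_X]
    fin_cases i
    · exact ⟨h.mul hX, rfl⟩
    · exact ⟨h.mul hY, rfl⟩

end MeromorphicGerm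

open MeromorphicGerm in
/-- The curve `x + y + t = γ`, `x ^ α + y ^ α + t ^ α = β` is transcendental. -/
theorem not_eventually_eval_rpow_curve_eq_zero {α β γ z₀ : ℝ} {X : ℝ → ℝ} (hα : Irrational α)
    (hX : AnalyticAt ℝ X z₀) (hx : 0 < X z₀) (hy : 0 < γ - z₀ - X z₀) (hz : 0 < z₀)
    (hcurve : ∀ᶠ t in 𝓝 z₀, X t ^ α + (γ - t - X t) ^ α + t ^ α = β)
    {P : MvPolynomial (Fin 2) ℝ} (hP : P ≠ 0) :
    ¬ ∀ᶠ t in 𝓝 z₀, MvPolynomial.eval ![X t, t] P = 0 := by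
  intro hPX
  set D := derivation z₀
  have hY : AnalyticAt ℝ (fun t ↦ γ - t - X t) z₀ := (analyticAt_const.sub analyticAt_id).sub hX
  have hZ : AnalyticAt ℝ (fun t ↦ t) z₀ := analyticAt_id
  obtain ⟨hu, hxu⟩ := isPowerPair_of α hX hx
  obtain ⟨hv, hyv⟩ := isPowerPair_of α hY hy
  obtain ⟨hw, hzw⟩ := isPowerPair_of α hZ hz
  set xg := of X hX.meromorphicAt
  set yg := of _ hY.meromorphicAt
  set zg := of _ hZ.meromorphicAt
  have hxpos := (hX.continuousAt.eventually_const_lt hx).filter_mono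
    (nhdsWithin_le_nhds (s := Set.Ioi z₀))
  have hypos := (hY.continuousAt.eventually_const_lt hy).filter_mono
    (nhdsWithin_le_nhds (s := Set.Ioi z₀))
  have hzpos := (hZ.continuousAt.eventually_const_lt hz).filter_mono
    (nhdsWithin_le_nhds (s := Set.Ioi z₀))
  have hDz : D zg = 1 := by
    refine (derivation_of _).trans (of_eq_iff (hg := .const 1 z₀) |>.2 (.of_eq ?_))
    ext t
    exact deriv_id t
  have hsum : xg + yg + zg = algebraMap ℝ _ γ := by
    rw [of_add, of_add, algebraMap_eq, of_eq_iff]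
    exact .of_forall fun t ↦ by ring
  have hpow : of _ hu + of _ hv + of _ hw = algebraMap ℝ _ β := by
    rw [of_add, of_add, algebraMap_eq, of_eq_iff]
    exact hcurve.filter_mono nhdsWithin_le_nhds
  have hs : D xg + D yg + D zg = 0 := by
    rw [← map_add, ← map_add, hsum, Derivation.map_algebraMap]
  have hp : D (of _ hu) + D (of _ hv) + D (of _ hw) = 0 := by
    rw [← map_add, ← map_add, hpow, Derivation.map_algebraMap]
  have hzK : zg ∈ algebraicOver zg :=
    mem_algebraicOver.2 (isAlgebraic_algebraMap
      (⟨zg, IntermediateField.mem_adjoin_simple_self ℝ zg⟩ : IntermediateField.adjoin ℝ {zg}))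
  have hxK : xg ∈ algebraicOver zg := by
    refine mem_algebraicOver_of_not_algebraicIndependent (D := D) (by simp [hDz]) fun hind ↦ ?_
    obtain ⟨h, hPg⟩ := aeval_of hX.meromorphicAt hZ.meromorphicAt P
    refine hP (algebraicIndependent_iff.1 hind P (hPg.trans ?_))
    exact (of_eq_iff (hg := .const 0 z₀)).2 (hPX.filter_mono nhdsWithin_le_nhds)
  have hyK : yg ∈ algebraicOver zg := by
    rw [show yg = algebraMap ℝ _ γ - xg - zg by rw [← hsum]; ring]
    exact sub_mem (sub_mem (algebraMap_mem _ γ) hxK) hzK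
  obtain ⟨hDx, hDy⟩ := (isThin_algebraicOver hDz exists_eq_algebraMap).deriv_eq_zero_of_sum hα
    hα.ne_zero hxu hyv hzw hxK hyK hzK hs hp
    (by
      rw [of_add, of_add]
      refine of_ne_zero _ ?_
      filter_upwards [hxpos, hypos, hzpos] with t h₁ h₂ h₃ using by positivity)
    (by
      rw [of_add]
      refine of_ne_zero _ ?_
      filter_upwards [hxpos, hypos, hzpos] with t h₁ h₂ h₃ using by positivity)
    (by
      rw [of_add]
      refine of_ne_zero _ ?_
      filter_upwards [hxpos, hypos, hzpos] with t h₁ h₂ h₃ using by positivity)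
    (by
      rw [of_add]
      refine of_ne_zero _ ?_
      filter_upwards [hxpos, hypos, hzpos] with t h₁ h₂ h₃ using by positivity)
    (by
      rw [of_add]
      refine of_ne_zero _ ?_
      filter_upwards [hxpos, hypos, hzpos] with t h₁ h₂ h₃ using by positivity)
  simp [hDx, hDy, hDz] at hs

theorem exists_ne_of_rpow_sum {d : ℕ} {α b c : ℝ} (hd : d ≠ 0) (hα1 : α ≠ 1) (hb : 1 < b)
    (hcd : c < Real.logb b d) {l : Fin d → ℝ} (hsum : ∑ i, l i = 1)
    (hpow : ∑ i, l i ^ α = b ^ (c * (1 - α))) : ∃ i j, l i ≠ l j := by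
  by_contra! hconst
  have hd' : (0 : ℝ) < d := by positivity
  have hl : ∀ i, l i = (d : ℝ)⁻¹ := by
    intro i
    rw [Finset.sum_congr rfl fun j _ ↦ hconst j i] at hsum
    simp only [Finset.sum_const, Finset.card_univ, Fintype.card_fin, nsmul_eq_mul] at hsum
    exact eq_inv_of_mul_eq_one_right hsum
  simp only [hl, Finset.sum_const, Finset.card_univ, Fintype.card_fin, nsmul_eq_mul] at hpow
  have hpow' : (d : ℝ) ^ (1 - α) = b ^ (c * (1 - α)) := by
    rw [← hpow, Real.rpow_sub hd', Real.rpow_one, Real.inv_rpow hd'.le, div_eq_mul_inv]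
  rw [Real.rpow_mul (by positivity),
    Real.rpow_left_inj (by positivity) (by positivity) (sub_ne_zero.2 hα1.symm)] at hpow'
  rw [hpow', Real.logb_rpow (by positivity) hb.ne'] at hcd
  exact hcd.false

theorem not_isSemialgebraic_of_ne {ι : Type} [Fintype ι] {α β : ℝ} (hα0 : α ≠ 0) (hα1 : α ≠ 1)
    (hα : Irrational α) {U : Set (ι → ℝ)} (hU : IsOpen U) {l : ι → ℝ} (hlU : l ∈ U)
    (hl : ∀ i, 0 < l i) (hsum : ∑ i, l i = 1) (hpow : ∑ i, l i ^ α = β) {i j k : ι}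
    (hij : l i ≠ l j) (hik : i ≠ k) (hjk : j ≠ k) :
    ¬ IsSemialgebraic (U ∩ {l : ι → ℝ | (∀ i, 0 < l i) ∧ ∑ i, l i = 1 ∧ ∑ i, l i ^ α = β}) := by
  classical
  intro hS
  have hne : i ≠ j := fun h ↦ hij (congrArg l h)
  obtain ⟨X, hX, hX0, hcurve⟩ :=
    exists_analyticAt_rpow_curve (α := α) hα0 hα1 (hl i) (hl j) (hl k) hij
  set γ := l i + l j + l k with hγ
  set w : ℝ → ℝ → ι → ℝ := fun s t ↦ replaceThree l i j k s (γ - t - s) t with hw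
  obtain ⟨P, hP, hloc⟩ := hS.exists_eventually_mem_iff
    (replaceThree (fun m ↦ MvPolynomial.C (l m)) i j k (MvPolynomial.X (0 : Fin 2))
      (MvPolynomial.C γ - MvPolynomial.X 1 - MvPolynomial.X 0) (MvPolynomial.X 1))
  have hq : ∀ s t : ℝ, (fun m ↦ MvPolynomial.eval ![s, t]
      (replaceThree (fun m ↦ MvPolynomial.C (l m)) i j k (MvPolynomial.X (0 : Fin 2))
        (MvPolynomial.C γ - MvPolynomial.X 1 - MvPolynomial.X 0) (MvPolynomial.X 1) m)) =
      w s t := by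
    intro s t
    ext m
    simp only [hw, replaceThree]
    split_ifs <;> simp
  have hY0 : γ - l k - X (l k) = l j := by rw [hX0, hγ]; ring
  have hXc := hX.continuousAt
  have hYc : ContinuousAt (fun t ↦ γ - t - X t) (l k) :=
    (continuousAt_const.sub continuousAt_id).sub hXc
  refine not_eventually_eval_rpow_curve_eq_zero hα hX (hX0 ▸ hl i) (hY0 ▸ hl j) (hl k) hcurve hP ?_
  have hwU : ∀ᶠ t in 𝓝 (l k), w (X t) t ∈ U := by
    have hwc : ContinuousAt (fun t ↦ w (X t) t) (l k) := by
      refine continuousAt_pi.2 fun m ↦ ?_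
      simp only [hw, replaceThree]
      split_ifs
      exacts [hXc, hYc, continuousAt_id, continuousAt_const]
    refine hwc.eventually_mem (hU.mem_nhds ?_)
    convert hlU using 1
    ext m
    simp only [hw, replaceThree, hX0]
    split_ifs with h₁ h₂ h₃ <;> simp [*]
  filter_upwards [hcurve, hwU, hXc.eventually_const_lt (hX0 ▸ hl i),
    hYc.eventually_const_lt (hY0 ▸ hl j), lt_mem_nhds (hl k),
    (hXc.prodMk hYc).eventually_mem
      ((isOpen_ne_fun continuous_fst continuous_snd).mem_nhds
        (show X (l k) ≠ γ - l k - X (l k) by rwa [hY0, hX0]))]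
    with t htc htU hXpos hYpos htpos hXY
  by_contra hPt
  have hmem : w (X t) t ∈
      U ∩ {l : ι → ℝ | (∀ i, 0 < l i) ∧ ∑ i, l i = 1 ∧ ∑ i, l i ^ α = β} := by
    refine ⟨htU, fun m ↦ ?_, ?_, ?_⟩
    · simp only [hw, replaceThree]
      split_ifs
      exacts [hXpos, hYpos, htpos, hl m]
    · refine (sum_replaceThree l hne hik hjk id _ _ _).trans ?_
      simp only [id, hsum, hγ]
      ring
    · refine (sum_replaceThree l hne hik hjk (· ^ α) _ _ _).trans ?_
      simp only [hpow, htc]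
      ring
  have hline : ∀ᶠ s in 𝓝 (X t), s ^ α + (γ - t - s) ^ α + t ^ α = l i ^ α + l j ^ α + l k ^ α := by
    have hc : Tendsto (fun s ↦ (![s, t] : Fin 2 → ℝ)) (𝓝 (X t)) (𝓝 ![X t, t]) := by
      refine Continuous.tendsto ?_ _
      fun_prop
    filter_upwards [hc.eventually (hloc _ hPt)] with s hs
    rw [hq, hq] at hs
    have h := (sum_replaceThree l hne hik hjk (· ^ α) _ _ _).symm.trans (hs.2 hmem).2.2.2
    simp only [hpow] at h
    linarith
  refine rpow_sub_rpow_ne_zero hα0 hα1 hXpos hYpos hXY ?_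
  exact (hasDerivAt_rpow_add_rpow_sub (t ^ α) hXpos hYpos).unique
    ((hasDerivAt_const _ _).congr_of_eventuallyEq hline)

/-- For `d ≥ 3`, irrational `α ∈ (0,1) ∪ (1,∞)`, base `b > 1` and `c ∈ (0, log_b d)`,
the level set of the classical Rényi entropy `S_α(λ) = c`, i.e. the set of strictly
positive probability vectors with `Σ λ_i^α = b^(c(1-α))`, is nowhere semialgebraic:
its intersection with any open set is not semialgebraic unless empty. -/
theorem classical_renyi_levelSet_nowhere_semialgebraic (d : ℕ) (hd : 3 ≤ d)
    (α : ℝ) (hα0 : 0 < α) (hα1 : α ≠ 1) (hirr : Irrational α)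
    (b c : ℝ) (hb : 1 < b) (hc0 : 0 < c) (hcd : c < Real.logb b d) :
    ∀ U : Set (Fin d → ℝ), IsOpen U →
      (U ∩ {l : Fin d → ℝ | (∀ i, 0 < l i) ∧ ∑ i, l i = 1 ∧
        ∑ i, l i ^ α = b ^ (c * (1 - α))}).Nonempty →
      ¬ IsSemialgebraic (U ∩ {l : Fin d → ℝ | (∀ i, 0 < l i) ∧ ∑ i, l i = 1 ∧
        ∑ i, l i ^ α = b ^ (c * (1 - α))}) := by
  rintro U hU ⟨l, hlU, hl, hsum, hpow⟩
  obtain ⟨i, j, hij⟩ := exists_ne_of_rpow_sum (by omega) hα1 hb hcd hsum hpow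
  obtain ⟨k, hk⟩ := Finset.exists_mem_notMem_of_card_lt_card (s := {i, j}) (t := Finset.univ)
    (Finset.card_le_two.trans_lt (by rw [Finset.card_fin]; exact hd))
  simp only [Finset.mem_univ, Finset.mem_insert, Finset.mem_singleton, not_or, true_and] at hk
  exact not_isSemialgebraic_of_ne hα0.ne' hα1 hirr hU hlU hl hsum hpow hij (Ne.symm hk.1)
    (Ne.symm hk.2)
end

section
/- Let a₁, a₂, a₃ > 0 with (a₁ + a₃)/a₂ irrational, and let β > 0, c > 0. There is no nonzero polynomial P ∈ ℝ[x, y] vanishing on the set {(λ₁, λ₂) ∈ ℝ² : λ₁, λ₂ > 0, λ₁ + λ₂ < c, λ₁^{a₁} λ₂^{a₂} (c - λ₁ - λ₂)^{a₃} = β} whenever this set is an infinite set. -/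
section Algebra

open Polynomial Bivariate
open scoped PowerSeries

/-- Over a complete local ring, a polynomial with nonzero reduction which takes a non-unit value has
a nonconstant monic factor. -/
theorem exists_monic_dvd_of_not_isUnit_eval {A : Type*} [CommRing A] [IsDomain A] [IsLocalRing A]
    [IsAdicComplete (IsLocalRing.maximalIdeal A) A] {P : A[X]}
    (hP : P.map (IsLocalRing.residue A) ≠ 0) {a : A} (ha : ¬ IsUnit (P.eval a)) :
    ∃ H : A[X], H.Monic ∧ 0 < H.natDegree ∧ H ∣ P := by
  set Q : A[X] := P.comp (X + C a) with hQ
  have hPQ : Q.comp (X - C a) = P := by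
    rw [hQ, comp_assoc]; simp
  have hQ0 : Q.map (IsLocalRing.residue A) ≠ 0 := by
    intro h
    apply hP
    rw [← hPQ, Polynomial.map_comp, h, zero_comp]
  set g : PowerSeries A := (Q : PowerSeries A) with hg
  have hg0 : g.map (IsLocalRing.residue A) ≠ 0 := by
    rwa [hg, ← Polynomial.polynomial_map_coe, Ne, Polynomial.coe_eq_zero_iff]
  have hfac := g.isWeierstrassFactorization_weierstrassDistinguished_weierstrassUnit hg0
  set H := g.weierstrassDistinguished hg0
  have hdeg : 0 < H.natDegree := by
    rw [hfac.natDegree_eq_toNat_order_map, Nat.pos_iff_ne_zero, Ne, ENat.toNat_eq_zero, not_or]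
    refine ⟨?_, by simpa using hg0⟩
    rw [← Ne, PowerSeries.order_ne_zero_iff_constCoeff_eq_zero,
      ← PowerSeries.coeff_zero_eq_constantCoeff_apply, PowerSeries.coeff_map, hg,
      Polynomial.coeff_coe, coeff_zero_eq_eval_zero, IsLocalRing.residue_eq_zero_iff,
      IsLocalRing.mem_maximalIdeal]
    simpa [hQ] using ha
  have hdvd : H ∣ Q := by
    have e := hfac.isDistinguishedAt.algEquivQuotient
    have h1 : hfac.isDistinguishedAt.algEquivQuotient (Ideal.Quotient.mk _ Q) = 0 := by
      change Ideal.Quotient.mk _ (Q : PowerSeries A) = 0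
      rw [Ideal.Quotient.eq_zero_iff_dvd]
      exact ⟨_, hfac.eq_mul⟩
    rw [map_eq_zero_iff _ (AlgEquiv.injective _), Ideal.Quotient.eq_zero_iff_dvd] at h1
    exact h1
  refine ⟨H.comp (X - C a), hfac.isDistinguishedAt.monic.comp_X_sub_C a, ?_, ?_⟩
  · rwa [natDegree_comp, natDegree_X_sub_C, mul_one]
  · rw [← hPQ]
    exact map_dvd (compRingHom (X - C a)) hdvd

theorem isIntegral_inv_sub_of_isUnit_eval {A L : Type*} [CommRing A] [Nontrivial A]
    [Field L] [Algebra A L] {P : A[X]} {x : L} (hx : aeval x P = 0) {a : A}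
    (ha : IsUnit (P.eval a)) :
    IsIntegral A (algebraMap A L a - x)⁻¹ := by
  set Q : A[X] := P.comp (C a - X) with hQ
  have hQ0 : Q.coeff 0 = P.eval a := by simp [hQ, coeff_zero_eq_eval_zero]
  have hQx : aeval (algebraMap A L a - x) Q = 0 := by simp [hQ, aeval_comp, hx]
  have hne : algebraMap A L a - x ≠ 0 := by
    intro h
    rw [h, ← coeff_zero_eq_aeval_zero', hQ0] at hQx
    have := ha.map (algebraMap A L)
    rw [hQx] at this
    exact not_isUnit_zero this
  obtain ⟨u, hu⟩ := ha
  have htr : Q.reverse.leadingCoeff = u := by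
    rw [reverse_leadingCoeff, trailingCoeff, natTrailingDegree_eq_zero.2, hQ0, hu]
    right; rw [hQ0, ← hu]; exact u.ne_zero
  refine ⟨C (↑u⁻¹ : A) * Q.reverse, ?_, ?_⟩
  · exact monic_C_mul_of_mul_leadingCoeff_eq_one (by simp [htr])
  · let := invertibleOfNonzero hne
    have := eval₂_reverse_mul_pow (algebraMap A L) (algebraMap A L a - x) Q
    rw [eval₂_mul]
    rw [← aeval_def _ Q, hQx, invOf_eq_inv] at this
    rw [(mul_eq_zero.1 this).resolve_right (pow_ne_zero _ hne), mul_zero]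

theorem exists_aeval_eq_zero_map_residue_ne_zero {A k L : Type*} [CommRing A] [IsDomain A]
    [IsDiscreteValuationRing A] [Field k] [Algebra A k] [IsFractionRing A k] [Field L] [Algebra k L]
    {x : L} (hx : IsIntegral k x) : ∃ (P : A[X]) (g : k), g ≠ 0 ∧
      P.map (algebraMap A k) = C g * minpoly k x ∧ P.map (IsLocalRing.residue A) ≠ 0 := by
  let := Classical.arbitrary (NormalizedGCDMonoid A)
  set G := minpoly k x
  obtain ⟨b, hb, hbG⟩ := IsLocalization.integerNormalization_spec (nonZeroDivisors A) G
  set N := IsLocalization.integerNormalization (nonZeroDivisors A) G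
  have hN : N ≠ 0 := by
    rw [Ne, IsLocalization.integerNormalization_eq_zero_iff le_rfl]
    exact minpoly.ne_zero hx
  have hc : algebraMap A k N.content ≠ 0 := by
    simpa [content_eq_zero_iff] using hN
  have hb0 : algebraMap A k b ≠ 0 := by
    simpa using nonZeroDivisors.ne_zero hb
  refine ⟨N.primPart, algebraMap A k b / algebraMap A k N.content, div_ne_zero hb0 hc, ?_, ?_⟩
  · have h1 : C (algebraMap A k N.content) * N.primPart.map (algebraMap A k) =
        C (algebraMap A k b) * G := by
      rw [← Polynomial.map_C, ← Polynomial.map_mul, ← eq_C_content_mul_primPart, hbG,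
        ← algebraMap_smul k, smul_eq_C_mul]
    rw [div_eq_inv_mul, C_mul, mul_assoc, ← h1, ← mul_assoc, ← C_mul, inv_mul_cancel₀ hc]
    simp
  · intro h
    obtain ⟨ϖ, hϖ⟩ := IsDiscreteValuationRing.exists_irreducible A
    have : C ϖ ∣ N.primPart := by
      rw [C_dvd_iff_dvd_coeff]
      intro i
      have := congr_arg (coeff · i) h
      simp only [coeff_map, coeff_zero, IsLocalRing.residue_eq_zero_iff,
        hϖ.maximalIdeal_eq, Ideal.mem_span_singleton] at this
      exact this
    exact hϖ.not_isUnit (N.isPrimitive_primPart _ this)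

/-- Over a complete discrete valuation ring, an algebraic element `x` is integral, or all the
`(a - x)⁻¹` are. -/
theorem isIntegral_or_forall_isIntegral_inv_sub {A k L : Type*} [CommRing A] [IsDomain A]
    [IsDiscreteValuationRing A] [IsAdicComplete (IsLocalRing.maximalIdeal A) A]
    [Field k] [Algebra A k] [IsFractionRing A k] [Field L] [Algebra k L] [Algebra A L]
    [IsScalarTower A k L] {x : L} (hx : IsIntegral k x) :
    IsIntegral A x ∨ ∀ a : A, IsIntegral A (algebraMap A L a - x)⁻¹ := by
  obtain ⟨P, g, hg, hPg, hP⟩ := exists_aeval_eq_zero_map_residue_ne_zero (A := A) hx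
  by_cases hu : ∀ a, IsUnit (P.eval a)
  · right
    intro a
    apply isIntegral_inv_sub_of_isUnit_eval _ (hu a)
    rw [← aeval_map_algebraMap k, hPg]
    simp
  · left
    push Not at hu
    obtain ⟨a, ha⟩ := hu
    obtain ⟨H, hH, hdeg, hHP⟩ := exists_monic_dvd_of_not_isUnit_eval hP ha
    refine ⟨H, hH, ?_⟩
    have h1 : H.map (algebraMap A k) ∣ minpoly k x := by
      have := Polynomial.map_dvd (algebraMap A k) hHP
      rw [hPg] at this
      exact (IsUnit.dvd_mul_left (isUnit_C.2 hg.isUnit)).1 this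
    have h2 : H.map (algebraMap A k) = minpoly k x := by
      apply eq_of_monic_of_associated (hH.map _) (minpoly.monic hx)
      refine (((minpoly.irreducible hx).dvd_iff.1 h1).resolve_left ?_).symm
      intro h
      have := natDegree_eq_zero_of_isUnit h
      rw [hH.natDegree_map] at this
      omega
    rw [← aeval_def, ← aeval_map_algebraMap k, h2, minpoly.aeval]

@[reducible]
def Differential.ofAddMonoidHom {A : Type*} [CommRing A] (f : A →+ A)
    (hf : ∀ a b, f (a * b) = a * f b + b * f a) : Differential A :=
  ⟨Derivation.mk' f.toIntLinearMap hf⟩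

theorem Differential.exists_extend_isFractionRing (A k : Type*) [CommRing A] [Field k]
    [Algebra A k] [IsFractionRing A k] [Differential A] :
    ∃ _ : Differential k, DifferentialAlgebra A k := by
  let f : A →+* TrivSqZeroExt k k :=
    { toFun a := .inl (algebraMap A k a) + .inr (algebraMap A k (Differential.deriv a))
      map_zero' := by ext <;> simp
      map_one' := by ext <;> simp
      map_add' a b := by ext <;> simp [Algebra.smul_def]
      map_mul' a b := by
        ext
        · simp
        · simp only [TrivSqZeroExt.snd_add, TrivSqZeroExt.snd_mul, TrivSqZeroExt.snd_inl,
            TrivSqZeroExt.snd_inr, TrivSqZeroExt.fst_add, TrivSqZeroExt.fst_inl,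
            TrivSqZeroExt.fst_inr, Derivation.leibniz, map_add, map_mul, smul_eq_mul,
            MulOpposite.smul_eq_mul_unop, MulOpposite.unop_op]
          ring }
  have hf (y : nonZeroDivisors A) : IsUnit (f y) := by
    rw [TrivSqZeroExt.isUnit_iff_isUnit_fst]
    simpa [f] using IsLocalization.map_units k y
  let F : k →+* TrivSqZeroExt k k := IsLocalization.lift (M := nonZeroDivisors A) hf
  have hF (a : A) : F (algebraMap A k a) = f a := IsLocalization.lift_eq hf a
  have hfst (x : k) : (F x).fst = x := by
    have : (TrivSqZeroExt.fstHom k k k : TrivSqZeroExt k k →+* k).comp F = RingHom.id k := by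
      apply IsLocalization.ringHom_ext (nonZeroDivisors A)
      ext a
      simp [hF, f]
    exact congr($this x)
  let D : Differential k := .ofAddMonoidHom
    ⟨⟨fun x ↦ (F x).snd, by simp⟩, fun x y ↦ by simp⟩ fun x y ↦ by
      change (F (x * y)).snd = x * (F y).snd + y * (F x).snd
      rw [map_mul, TrivSqZeroExt.snd_mul, hfst, hfst, op_smul_eq_smul, smul_eq_mul,
        smul_eq_mul]
  refine ⟨D, ⟨fun a ↦ ?_⟩⟩
  change (F (algebraMap A k a)).snd = _
  rw [hF]
  change (0 : k) + _ = _
  rw [zero_add]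
  rfl

noncomputable instance Polynomial.instDifferential {R : Type*} [CommRing R] : Differential R[X] :=
  .ofAddMonoidHom derivative.toAddMonoidHom fun a b ↦ by
    simp [derivative_mul]
    ring

noncomputable instance PowerSeries.instDifferential {R : Type*} [CommRing R] :
    Differential (PowerSeries R) :=
  .ofAddMonoidHom (PowerSeries.derivative R).toLinearMap.toAddMonoidHom fun a b ↦
    (PowerSeries.derivative R).leibniz a b

instance PowerSeries.instDifferentialAlgebra {R : Type*} [CommRing R] :
    DifferentialAlgebra R[X] (PowerSeries R) :=
  ⟨fun p ↦ by
    exact (PowerSeries.derivative_coe p)⟩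

noncomputable instance FractionRing.instDifferential {A : Type*} [CommRing A] [IsDomain A]
    [Differential A] : Differential (FractionRing A) :=
  (Differential.exists_extend_isFractionRing A (FractionRing A)).choose

instance FractionRing.instDifferentialAlgebra {A : Type*} [CommRing A] [IsDomain A]
    [Differential A] : DifferentialAlgebra A (FractionRing A) :=
  (Differential.exists_extend_isFractionRing A (FractionRing A)).choose_spec

theorem DifferentialAlgebra.trans (A B C : Type*) [CommRing A] [CommRing B] [CommRing C]
    [Algebra A B] [Algebra B C] [Algebra A C] [IsScalarTower A B C] [Differential A]
    [Differential B] [Differential C] [DifferentialAlgebra A B] [DifferentialAlgebra B C] :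
    DifferentialAlgebra A C :=
  ⟨fun a ↦ by simp only [IsScalarTower.algebraMap_apply A B C, deriv_algebraMap]⟩

namespace PowerSeries

variable {F : Type*} [Field F]

theorem exists_eq_zpow_mul_unit {f : FractionRing F⟦X⟧} (hf : f ≠ 0) :
    ∃ (m : ℤ) (u : F⟦X⟧ˣ), f = algebraMap F⟦X⟧ _ X ^ m * algebraMap F⟦X⟧ _ u := by
  obtain ⟨a, b, hb, rfl⟩ := IsFractionRing.div_surjective (A := F⟦X⟧) f
  have hX : Irreducible (X : F⟦X⟧) := X_prime.irreducible
  have hX0 : algebraMap F⟦X⟧ (FractionRing F⟦X⟧) X ≠ 0 := by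
    simp
  have ha : a ≠ 0 := by rintro rfl; simp at hf
  obtain ⟨p, u, rfl⟩ := IsDiscreteValuationRing.eq_unit_mul_pow_irreducible ha hX
  obtain ⟨q, v, rfl⟩ := IsDiscreteValuationRing.eq_unit_mul_pow_irreducible
    (nonZeroDivisors.ne_zero hb) hX
  refine ⟨p - q, u * v⁻¹, ?_⟩
  have hv : algebraMap F⟦X⟧ (FractionRing F⟦X⟧) v * algebraMap F⟦X⟧ _ ↑v⁻¹ = 1 := by
    rw [← map_mul, Units.mul_inv, map_one]
  rw [zpow_sub₀ hX0, zpow_natCast, zpow_natCast]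
  simp only [map_mul, map_pow, Units.val_mul]
  rw [eq_inv_of_mul_eq_one_right hv]
  field_simp

theorem nonneg_of_isIntegral_zpow_mul_unit {m : ℤ} {u : F⟦X⟧ˣ}
    (h : IsIntegral F⟦X⟧ (algebraMap F⟦X⟧ (FractionRing F⟦X⟧) X ^ m * algebraMap F⟦X⟧ _ u)) :
    0 ≤ m := by
  obtain ⟨b, hb⟩ := IsIntegrallyClosed.isIntegral_iff.1 h
  have hX0 : algebraMap F⟦X⟧ (FractionRing F⟦X⟧) X ≠ 0 := by
    simp
  by_contra! hm
  obtain ⟨n, rfl⟩ : ∃ n : ℕ, m = -(n + 1 : ℕ) := ⟨(-m - 1).toNat, by omega⟩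
  rw [zpow_neg, zpow_natCast, eq_inv_mul_iff_mul_eq₀ (pow_ne_zero _ hX0), ← map_pow,
    ← map_mul] at hb
  have := congr(constantCoeff $(IsFractionRing.injective F⟦X⟧ (FractionRing F⟦X⟧) hb))
  have h2 := u.isUnit.map (constantCoeff (R := F))
  rw [← this] at h2
  simp at h2

theorem eq_zero_of_isIntegral_zpow_mul_unit {m : ℤ} {u : F⟦X⟧ˣ}
    (h : IsIntegral F⟦X⟧ (algebraMap F⟦X⟧ (FractionRing F⟦X⟧) X ^ m * algebraMap F⟦X⟧ _ u))
    (h' : IsIntegral F⟦X⟧ (algebraMap F⟦X⟧ (FractionRing F⟦X⟧) X ^ m * algebraMap F⟦X⟧ _ u)⁻¹) :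
    m = 0 := by
  apply le_antisymm _ (nonneg_of_isIntegral_zpow_mul_unit h)
  have hu : algebraMap F⟦X⟧ (FractionRing F⟦X⟧) u * algebraMap F⟦X⟧ _ ↑u⁻¹ = 1 := by
    rw [← map_mul, Units.mul_inv, map_one]
  rw [mul_inv, ← zpow_neg, ← eq_inv_of_mul_eq_one_right hu] at h'
  have := nonneg_of_isIntegral_zpow_mul_unit h'
  omega

theorem deriv_X : Differential.deriv (X : F⟦X⟧) = 1 := derivative_X

theorem exists_mul_logDeriv_eq (m : ℤ) (u : F⟦X⟧ˣ) :
    ∃ a : F⟦X⟧, algebraMap F⟦X⟧ (FractionRing F⟦X⟧) X *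
      Differential.logDeriv (algebraMap F⟦X⟧ (FractionRing F⟦X⟧) X ^ m * algebraMap F⟦X⟧ _ u) =
      m + algebraMap F⟦X⟧ _ (X * a) := by
  have hX0 : algebraMap F⟦X⟧ (FractionRing F⟦X⟧) X ≠ 0 := by
    simp
  have hu : algebraMap F⟦X⟧ (FractionRing F⟦X⟧) u * algebraMap F⟦X⟧ _ ↑u⁻¹ = 1 := by
    rw [← map_mul, Units.mul_inv, map_one]
  have hu0 := left_ne_zero_of_mul_eq_one hu
  have hX : algebraMap F⟦X⟧ (FractionRing F⟦X⟧) X *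
      Differential.logDeriv (algebraMap F⟦X⟧ (FractionRing F⟦X⟧) X) = 1 := by
    rw [Differential.logDeriv, deriv_algebraMap, deriv_X, map_one, mul_one_div_cancel hX0]
  obtain ⟨p, q, rfl⟩ : ∃ p q : ℕ, m = p - q := ⟨m.toNat, (-m).toNat, by omega⟩
  refine ⟨Differential.deriv (u : F⟦X⟧) * ↑u⁻¹, ?_⟩
  rw [Differential.logDeriv_mul _ _ (zpow_ne_zero _ hX0) hu0, zpow_sub₀ hX0, zpow_natCast,
    zpow_natCast, Differential.logDeriv_div _ _ (pow_ne_zero _ hX0) (pow_ne_zero _ hX0),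
    Differential.logDeriv_pow, Differential.logDeriv_pow,
    Differential.logDeriv.eq_1 (algebraMap F⟦X⟧ (FractionRing F⟦X⟧) u), deriv_algebraMap,
    div_eq_mul_inv, ← eq_inv_of_mul_eq_one_right hu, map_mul, map_mul]
  push_cast
  linear_combination (p - q : FractionRing F⟦X⟧) * hX

theorem add_add_eq_zero_of_logDeriv {p q : ℤ} {u v : F⟦X⟧ˣ} {a b c : F}
    (h : algebraMap F⟦X⟧ (FractionRing F⟦X⟧) (C a) * Differential.logDeriv
        (algebraMap F⟦X⟧ (FractionRing F⟦X⟧) X ^ p * algebraMap F⟦X⟧ _ u) +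
      algebraMap F⟦X⟧ (FractionRing F⟦X⟧) (C b) *
        Differential.logDeriv (algebraMap F⟦X⟧ (FractionRing F⟦X⟧) X) +
      algebraMap F⟦X⟧ (FractionRing F⟦X⟧) (C c) * Differential.logDeriv
        (algebraMap F⟦X⟧ (FractionRing F⟦X⟧) X ^ q * algebraMap F⟦X⟧ _ v) = 0) :
    a * p + b + c * q = 0 := by
  have hX0 : algebraMap F⟦X⟧ (FractionRing F⟦X⟧) X ≠ 0 := by
    simp
  have hX : algebraMap F⟦X⟧ (FractionRing F⟦X⟧) X *
      Differential.logDeriv (algebraMap F⟦X⟧ (FractionRing F⟦X⟧) X) = 1 := by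
    rw [Differential.logDeriv, deriv_algebraMap, deriv_X, map_one, mul_one_div_cancel hX0]
  obtain ⟨r, hr⟩ := exists_mul_logDeriv_eq p u
  obtain ⟨s, hs⟩ := exists_mul_logDeriv_eq q v
  have key : algebraMap F⟦X⟧ (FractionRing F⟦X⟧)
      (C a * ((p : F⟦X⟧) + X * r) + C b + C c * ((q : F⟦X⟧) + X * s)) = 0 := by
    simp only [map_add, map_mul, map_intCast] at hr hs ⊢
    linear_combination algebraMap F⟦X⟧ (FractionRing F⟦X⟧) X * h -
      algebraMap F⟦X⟧ (FractionRing F⟦X⟧) (C a) * hr -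
      algebraMap F⟦X⟧ (FractionRing F⟦X⟧) (C c) * hs -
      algebraMap F⟦X⟧ (FractionRing F⟦X⟧) (C b) * hX
  rw [map_eq_zero_iff _ (IsFractionRing.injective _ _)] at key
  simpa using congr(constantCoeff $key)

end PowerSeries

theorem Differential.algebraMap_logDeriv_norm {k L : Type*} [Field k] [Field L] [Algebra k L]
    [FiniteDimensional k L] [IsGalois k L] [Differential k] [Differential L]
    [DifferentialAlgebra k L] {x : L} (hx : x ≠ 0) :
    algebraMap k L (logDeriv (Algebra.norm k x)) = ∑ σ : Gal(L/k), σ (logDeriv x) := by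
  rw [← logDeriv_algebraMap, Algebra.norm_eq_prod_automorphisms, logDeriv_prod _ _ _ (by simpa)]
  refine Finset.sum_congr rfl fun σ _ ↦ ?_
  rw [logDeriv, logDeriv, map_div₀, algEquiv_deriv']

namespace PowerSeries

theorem not_logDeriv_relation {F L : Type*} [Field F] [LinearOrder F] [IsStrictOrderedRing F]
    [Field L] [Algebra (FractionRing F⟦X⟧) L]
    [Algebra F⟦X⟧ L] [IsScalarTower F⟦X⟧ (FractionRing F⟦X⟧) L]
    [FiniteDimensional (FractionRing F⟦X⟧) L] [IsGalois (FractionRing F⟦X⟧) L] [Differential L]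
    [DifferentialAlgebra (FractionRing F⟦X⟧) L] {a₁ a₂ a₃ c : F} (h₁ : 0 < a₁) (h₂ : 0 < a₂)
    (h₃ : 0 < a₃) (h : ∀ r : ℚ, (r : F) ≠ (a₁ + a₃) / a₂) {x z : L} (hx : x ≠ 0) (hz : z ≠ 0)
    (hxz : x + z = algebraMap F⟦X⟧ L (C c - X))
    (hrel : algebraMap F⟦X⟧ L (C a₁) * Differential.logDeriv x +
      algebraMap F⟦X⟧ L (C a₂) * Differential.logDeriv (algebraMap F⟦X⟧ L X) +
      algebraMap F⟦X⟧ L (C a₃) * Differential.logDeriv z = 0) : False := by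
  set k := FractionRing F⟦X⟧ with hk
  set n := Fintype.card Gal(L/k)
  have hn : 0 < n := Fintype.card_pos
  have hNx : Algebra.norm k x ≠ 0 := Algebra.norm_ne_zero_iff.2 hx
  have hNz : Algebra.norm k z ≠ 0 := Algebra.norm_ne_zero_iff.2 hz
  obtain ⟨p, u, hp⟩ := exists_eq_zpow_mul_unit hNx
  obtain ⟨q, v, hq⟩ := exists_eq_zpow_mul_unit hNz
  have hA (a : F⟦X⟧) : algebraMap F⟦X⟧ L a = algebraMap k L (algebraMap _ k a) :=
    IsScalarTower.algebraMap_apply ..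
  have key : a₁ * p + n * a₂ + a₃ * q = 0 := by
    apply add_add_eq_zero_of_logDeriv (u := u) (v := v)
    rw [← hp, ← hq]
    apply (algebraMap k L).injective
    have h1 : ∑ σ : Gal(L/k), σ (algebraMap F⟦X⟧ L (C a₁) * Differential.logDeriv x +
      algebraMap F⟦X⟧ L (C a₂) * Differential.logDeriv (algebraMap F⟦X⟧ L X) +
      algebraMap F⟦X⟧ L (C a₃) * Differential.logDeriv z) = 0 := by simp [hrel]
    simp only [map_add, map_mul, hA, AlgEquiv.commutes, Differential.logDeriv_algebraMap,
      Finset.sum_add_distrib, ← Finset.mul_sum, ← Differential.algebraMap_logDeriv_norm hx,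
      ← Differential.algebraMap_logDeriv_norm hz, Finset.sum_const, Finset.card_univ,
      nsmul_eq_mul, map_natCast, map_zero] at h1 ⊢
    exact (by rw [← h1]; ring)
  have hinv {w : L} (hw : w ≠ 0) : Algebra.norm k w⁻¹ = (Algebra.norm k w)⁻¹ :=
    eq_inv_of_mul_eq_one_left (by rw [← map_mul, inv_mul_cancel₀ hw, map_one])
  have hnorm {w : L} (hw : IsIntegral F⟦X⟧ w) : IsIntegral F⟦X⟧ (Algebra.norm k w) :=
    Algebra.isIntegral_norm k hw
  have : IsAdicComplete (IsLocalRing.maximalIdeal F⟦X⟧) F⟦X⟧ := by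
    rw [maximalIdeal_eq_span_X]
    infer_instance
  rcases isIntegral_or_forall_isIntegral_inv_sub (A := F⟦X⟧) (k := k)
    (Algebra.IsIntegral.isIntegral x) with hxi | hxi
  · have hzi : IsIntegral F⟦X⟧ z := by
      rw [← add_sub_cancel_left x z, hxz]
      exact isIntegral_algebraMap.sub hxi
    have hp0 : 0 ≤ p := nonneg_of_isIntegral_zpow_mul_unit (hp ▸ hnorm hxi)
    have hq0 : 0 ≤ q := nonneg_of_isIntegral_zpow_mul_unit (hq ▸ hnorm hzi)
    have : 0 < a₁ * p + n * a₂ + a₃ * q := by positivity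
    exact this.ne' key
  · have e1 := hxi 0
    have e2 := hxi (C c - X)
    rw [← hxz, add_sub_cancel_left] at e2
    have f1 : IsIntegral F⟦X⟧ (z / x) := by
      have : z / x = - (algebraMap F⟦X⟧ L (C c - X) * (algebraMap F⟦X⟧ L 0 - x)⁻¹) - 1 := by
        rw [← hxz, map_zero]; field
      rw [this]
      exact (isIntegral_algebraMap.mul e1).neg.sub isIntegral_one
    have f2 : IsIntegral F⟦X⟧ (z / x)⁻¹ := by
      have : (z / x)⁻¹ = algebraMap F⟦X⟧ L (C c - X) * z⁻¹ - 1 := by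
        rw [← hxz]; field
      rw [this]
      exact (isIntegral_algebraMap.mul e2).sub isIntegral_one
    have hpq : q - p = 0 := by
      have hX0 : algebraMap F⟦X⟧ k X ≠ 0 := by simp [k]
      have hu : algebraMap F⟦X⟧ k u * algebraMap F⟦X⟧ _ ↑u⁻¹ = 1 := by
        rw [← map_mul, Units.mul_inv, map_one]
      have : Algebra.norm k (z / x) = algebraMap F⟦X⟧ k X ^ (q - p) *
          algebraMap F⟦X⟧ k ↑(v * u⁻¹) := by
        rw [div_eq_mul_inv, map_mul, hinv hx, hp, hq, zpow_sub₀ hX0, Units.val_mul, map_mul,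
          eq_inv_of_mul_eq_one_right hu]
        field
      apply eq_zero_of_isIntegral_zpow_mul_unit (u := v * u⁻¹)
      · rw [← this]; exact hnorm f1
      · rw [← this, ← hinv (div_ne_zero hz hx)]; exact hnorm f2
    obtain rfl : q = p := by omega
    have hq0 : (q : F) ≠ 0 := by
      intro h0
      rw [h0] at key
      have : 0 < n * a₂ := by positivity
      linarith
    refine h (-n / q) ?_
    push_cast
    field_simp
    linear_combination -key

end PowerSeries

theorem Ideal.IsPrime.exists_aeval_eq_zero_iff {D : Type*} (M : Type*) [CommRing D] [IsDomain D]
    [Field M] [IsAlgClosed M] [Algebra D M] [FaithfulSMul D M] {𝔭 : Ideal D[X]} (h𝔭 : 𝔭.IsPrime)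
    (hne : 𝔭 ≠ ⊥) (hC : ∀ f : D, C f ∈ 𝔭 → f = 0) :
    ∃ x : M, ∀ F : D[X], aeval x F = 0 ↔ F ∈ 𝔭 := by
  have hinj : Function.Injective (algebraMap D (D[X] ⧸ 𝔭)) := by
    rw [injective_iff_map_eq_zero]
    exact fun f hf ↦ hC f (Ideal.Quotient.eq_zero_iff_mem.1 hf)
  have : FaithfulSMul D (D[X] ⧸ 𝔭) := (faithfulSMul_iff_algebraMap_injective _ _).2 hinj
  have hmk (F : D[X]) : aeval (Ideal.Quotient.mk 𝔭 X) F = Ideal.Quotient.mk 𝔭 F := by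
    have : aeval (Ideal.Quotient.mk 𝔭 X) = Ideal.Quotient.mkₐ D 𝔭 := by ext; simp
    rw [this]; rfl
  obtain ⟨F₀, hF₀, hF₀0⟩ := Submodule.exists_mem_ne_zero_of_ne_bot hne
  have hX : IsAlgebraic D (Ideal.Quotient.mk 𝔭 X) :=
    ⟨F₀, hF₀0, by rwa [hmk, Ideal.Quotient.eq_zero_iff_mem]⟩
  have hS : Algebra.IsAlgebraic D (D[X] ⧸ 𝔭) := by
    refine ⟨fun s ↦ ?_⟩
    obtain ⟨F, rfl⟩ := Ideal.Quotient.mk_surjective s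
    rw [← hmk]
    exact Algebra.isAlgebraic_adjoin_singleton_iff.2 hX _ (aeval_mem_adjoin_singleton _ _)
  let φ : (D[X] ⧸ 𝔭) →ₐ[D] M := IsAlgClosed.lift
  have hφ : Function.Injective φ := by
    rw [injective_iff_map_eq_zero]
    intro s hs
    by_contra hs0
    obtain ⟨r, hr, t, ht⟩ := (hS.isAlgebraic s).exists_nonzero_dvd
      (mem_nonZeroDivisors_of_ne_zero hs0)
    have := congr(φ $ht)
    rw [φ.commutes, map_mul, hs, zero_mul, FaithfulSMul.algebraMap_eq_zero_iff] at this
    exact hr this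
  refine ⟨φ (Ideal.Quotient.mk 𝔭 X), fun F ↦ ?_⟩
  rw [aeval_algHom_apply, map_eq_zero_iff _ hφ, hmk, Ideal.Quotient.eq_zero_iff_mem]

theorem Polynomial.exists_mem_derivative_notMem {D : Type*} [CommRing D] [IsDomain D] [CharZero D]
    {I : Ideal D[X]} (hne : I ≠ ⊥) (hC : ∀ f : D, C f ∈ I → f = 0) :
    ∃ F ∈ I, derivative F ∉ I := by
  have hex : ∃ n, ∃ F ∈ I, F ≠ 0 ∧ F.natDegree = n := by
    obtain ⟨F₀, hF₀, hF₀0⟩ := Submodule.exists_mem_ne_zero_of_ne_bot hne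
    exact ⟨_, F₀, hF₀, hF₀0, rfl⟩
  classical
  obtain ⟨F, hF, hF0, hn⟩ := Nat.find_spec hex
  have hdeg : F.natDegree ≠ 0 := by
    intro h0
    rw [eq_C_of_natDegree_eq_zero h0] at hF hF0
    exact hF0 (by rw [hC _ hF, C_0])
  refine ⟨F, hF, fun h ↦ ?_⟩
  refine Nat.find_min hex (m := (derivative F).natDegree) ?_ ⟨_, h, fun h0 ↦ ?_, rfl⟩
  · rw [← hn]; exact natDegree_derivative_lt hdeg
  · exact hdeg (derivative_eq_zero.1 h0)

namespace Polynomial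

theorem false_of_aeval_eq_zero_iff {F L : Type*} [Field F] [LinearOrder F] [IsStrictOrderedRing F]
    [Field L] [Algebra (FractionRing F⟦X⟧) L]
    [Algebra F⟦X⟧ L] [IsScalarTower F⟦X⟧ (FractionRing F⟦X⟧) L]
    [Algebra F[X] L] [IsScalarTower F[X] F⟦X⟧ L]
    [FiniteDimensional (FractionRing F⟦X⟧) L] [IsGalois (FractionRing F⟦X⟧) L] [Differential L]
    [DifferentialAlgebra (FractionRing F⟦X⟧) L] {a₁ a₂ a₃ c : F} (h₁ : 0 < a₁) (h₂ : 0 < a₂)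
    (h₃ : 0 < a₃) (h : ∀ r : ℚ, (r : F) ≠ (a₁ + a₃) / a₂) {I : Ideal F[X][Y]} (hne : I ≠ ⊥)
    (hC : ∀ f : F[X], C f ∈ I → f = 0) (hX : X ∉ I) (hZ : C (C c - X) - X ∉ I)
    (hδ : ∀ G ∈ I,
      (C (C a₁ * X) * (C (C c - X) - X) - C (C a₃ * X) * X) * Differential.mapCoeffs G -
      (C (C a₂) * X * (C (C c - X) - X) - C (C a₃ * X) * X) * derivative G ∈ I)
    {x : L} (hx : ∀ G : F[X][Y], aeval x G = 0 ↔ G ∈ I) : False := by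
  have : DifferentialAlgebra F⟦X⟧ L := .trans _ (FractionRing F⟦X⟧) _
  have : DifferentialAlgebra F[X] L := .trans _ F⟦X⟧ _
  have hA (f : F[X]) : algebraMap F[X] L f = algebraMap F⟦X⟧ L (f : F⟦X⟧) :=
    IsScalarTower.algebraMap_apply F[X] F⟦X⟧ L f
  have hx0 : x ≠ 0 := by simpa using (hx X).not.2 hX
  set y := algebraMap F[X] L X with hy
  set z := algebraMap F[X] L (C c) - y - x with hz
  have hz0 : z ≠ 0 := by simpa [hz, hy] using (hx _).not.2 hZ
  have hy0 : y ≠ 0 := by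
    have := (hx (C X)).not.2 fun h ↦ X_ne_zero (hC X h)
    simpa using this
  have hdy : Differential.deriv y = 1 := by
    rw [hy, deriv_algebraMap, ← map_one (algebraMap F[X] L)]
    exact congrArg _ derivative_X
  have hdc : Differential.deriv (algebraMap F[X] L (C c)) = 0 := by
    rw [deriv_algebraMap, ← map_zero (algebraMap F[X] L)]
    exact congrArg _ derivative_C
  obtain ⟨G, hG, hG'⟩ := exists_mem_derivative_notMem hne hC
  have e1 := Differential.deriv_aeval_eq x G
  have e2 := (hx _).2 (hδ G hG)
  have e3 := (hx _).not.2 hG'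
  rw [(hx G).2 hG, map_zero] at e1
  simp only [map_sub, map_mul, aeval_C, aeval_X, ← hy, ← hz] at e2
  have key : (algebraMap F[X] L (C a₁) * y * z - algebraMap F[X] L (C a₃) * y * x) *
      Differential.deriv x +
      (algebraMap F[X] L (C a₂) * x * z - algebraMap F[X] L (C a₃) * y * x) = 0 := by
    apply mul_right_cancel₀ e3
    rw [zero_mul]
    linear_combination -(algebraMap F[X] L (C a₁) * y * z -
      algebraMap F[X] L (C a₃) * y * x) * e1 - e2
  refine PowerSeries.not_logDeriv_relation (c := c) h₁ h₂ h₃ h hx0 hz0 ?_ ?_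
  · simp [hz, hy, hA]
  · rw [← coe_C, ← coe_C, ← coe_C, ← coe_X, ← hA, ← hA, ← hA, ← hA, ← hy]
    rw [Differential.logDeriv, Differential.logDeriv, Differential.logDeriv, hdy]
    have hdz : Differential.deriv z = -1 - Differential.deriv x := by
      rw [hz, map_sub, map_sub, hdc, hdy]; ring
    rw [hdz]
    field_simp
    linear_combination key

theorem false_of_isPrime {F : Type*} [Field F] [LinearOrder F] [IsStrictOrderedRing F]
    {a₁ a₂ a₃ c : F} (h₁ : 0 < a₁) (h₂ : 0 < a₂) (h₃ : 0 < a₃)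
    (h : ∀ r : ℚ, (r : F) ≠ (a₁ + a₃) / a₂) {I : Ideal F[X][Y]} (hI : I.IsPrime) (hne : I ≠ ⊥)
    (hC : ∀ f : F[X], C f ∈ I → f = 0) (hX : X ∉ I) (hZ : C (C c - X) - X ∉ I)
    (hδ : ∀ G ∈ I,
      (C (C a₁ * X) * (C (C c - X) - X) - C (C a₃ * X) * X) * Differential.mapCoeffs G -
      (C (C a₂) * X * (C (C c - X) - X) - C (C a₃ * X) * X) * derivative G ∈ I) : False := by
  have : CharZero F⟦X⟧ := charZero_of_injective_algebraMap (algebraMap F F⟦X⟧).injective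
  have : CharZero (FractionRing F⟦X⟧) :=
    charZero_of_injective_algebraMap (IsFractionRing.injective F⟦X⟧ _)
  have : FaithfulSMul F[X] (AlgebraicClosure (FractionRing F⟦X⟧)) := by
    rw [faithfulSMul_iff_algebraMap_injective,
      IsScalarTower.algebraMap_eq F[X] F⟦X⟧ (AlgebraicClosure (FractionRing F⟦X⟧)),
      IsScalarTower.algebraMap_eq F⟦X⟧ (FractionRing F⟦X⟧) (AlgebraicClosure (FractionRing F⟦X⟧))]
    exact ((algebraMap (FractionRing F⟦X⟧) _).injective.comp
      (IsFractionRing.injective F⟦X⟧ _)).comp (Polynomial.coe_injective F)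
  obtain ⟨x, hx⟩ := hI.exists_aeval_eq_zero_iff (AlgebraicClosure (FractionRing F⟦X⟧)) hne hC
  let E := IntermediateField.adjoin (FractionRing F⟦X⟧) {x}
  have : FiniteDimensional (FractionRing F⟦X⟧) E :=
    IntermediateField.adjoin.finiteDimensional (Algebra.IsIntegral.isIntegral x)
  let L := IntermediateField.normalClosure (FractionRing F⟦X⟧) E
    (AlgebraicClosure (FractionRing F⟦X⟧))
  have hxL : x ∈ L :=
    IntermediateField.le_normalClosure E (IntermediateField.mem_adjoin_simple_self _ x)
  have : Normal (FractionRing F⟦X⟧) L := inferInstance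
  have : IsGalois (FractionRing F⟦X⟧) L := { }
  have : IsScalarTower F[X] F⟦X⟧ L := .of_algebraMap_eq fun f ↦ Subtype.ext <|
    IsScalarTower.algebraMap_apply F[X] F⟦X⟧ (AlgebraicClosure (FractionRing F⟦X⟧)) f
  have : IsScalarTower F[X] L (AlgebraicClosure (FractionRing F⟦X⟧)) :=
    .of_algebraMap_eq fun f ↦ rfl
  refine false_of_aeval_eq_zero_iff (L := L) h₁ h₂ h₃ h hne hC hX hZ hδ (x := ⟨x, hxL⟩) fun G ↦ ?_
  rw [← hx, ← map_eq_zero_iff (algebraMap L (AlgebraicClosure (FractionRing F⟦X⟧)))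
    (algebraMap L _).injective, ← aeval_algebraMap_apply]
  rfl

theorem hasDerivAt_evalEval {g : ℝ → ℝ} {g' y : ℝ} (hg : HasDerivAt g g' y) (G : ℝ[X][Y]) :
    HasDerivAt (fun t ↦ G.evalEval t (g t)) ((Differential.mapCoeffs G).evalEval y (g y) +
      (derivative G).evalEval y (g y) * g') y := by
  induction G using Polynomial.induction_on' with
  | add p q hp hq =>
    simp only [map_add, evalEval_add]
    convert! hp.add hq using 1
    ring
  | monomial n f =>
    simp only [evalEval, eval_monomial, Differential.mapCoeffs_monomial, derivative_monomial,
      eval_mul, eval_pow, eval_C, eval_natCast]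
    convert! (f.hasDerivAt y).mul (hg.pow n) using 1
    simp only [Pi.pow_apply]
    change (derivative f).eval y * _ + _ = _
    ring

theorem continuous_evalEval (G : ℝ[X][Y]) : Continuous fun p : ℝ × ℝ ↦ G.evalEval p.1 p.2 := by
  induction G using Polynomial.induction_on' with
  | add p q hp hq =>
    simp only [evalEval_add]
    exact hp.add hq
  | monomial n f =>
    simp only [evalEval, eval_monomial, eval_mul, eval_pow, eval_C]
    fun_prop

/-- The ideal of bivariate polynomials vanishing on the graph `{(y, g y) | y ∈ V}`. -/
noncomputable def graphIdeal {F : Type*} [CommRing F] (g : F → F) (V : Set F) : Ideal F[X][Y] :=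
  ⨅ y ∈ V, RingHom.ker (evalEvalRingHom y (g y))

theorem mem_graphIdeal {F : Type*} [CommRing F] {g : F → F} {V : Set F} {G : F[X][Y]} :
    G ∈ graphIdeal g V ↔ ∀ y ∈ V, G.evalEval y (g y) = 0 := by
  simp [graphIdeal, RingHom.mem_ker]

theorem graphIdeal_anti {F : Type*} [CommRing F] {g : F → F} {V W : Set F} (h : V ⊆ W) :
    graphIdeal g W ≤ graphIdeal g V := fun _ hG ↦
  mem_graphIdeal.2 fun y hy ↦ mem_graphIdeal.1 hG y (h hy)

theorem exists_isOpen_isPrime_graphIdeal {g : ℝ → ℝ} {U : Set ℝ} (hU : IsOpen U)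
    (hne : U.Nonempty) (hg : ContinuousOn g U) :
    ∃ V ⊆ U, IsOpen V ∧ V.Nonempty ∧ (graphIdeal g V).IsPrime := by
  obtain ⟨I, ⟨V, hVU, hVo, hV, rfl⟩, hmax⟩ := (wellFounded_gt (α := Ideal ℝ[X][Y])).has_min
    {I | ∃ V ⊆ U, IsOpen V ∧ V.Nonempty ∧ I = graphIdeal g V} ⟨_, U, subset_rfl, hU, hne, rfl⟩
  refine ⟨V, hVU, hVo, hV, ⟨fun h ↦ ?_, fun {A B} hAB ↦ ?_⟩⟩
  · obtain ⟨y, hy⟩ := hV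
    simpa using mem_graphIdeal.1 ((Ideal.eq_top_iff_one _).1 h) y hy
  · by_contra! hcon
    obtain ⟨hA, hB⟩ := hcon
    have hc : ContinuousOn (fun y ↦ A.evalEval y (g y)) V :=
      (continuous_evalEval A).comp_continuousOn (continuousOn_id.prodMk (hg.mono hVU))
    have hWo := hc.isOpen_inter_preimage hVo (isOpen_compl_singleton (x := (0 : ℝ)))
    rw [mem_graphIdeal] at hA
    push Not at hA
    obtain ⟨y, hy, hAy⟩ := hA
    have hWV := Set.inter_subset_left (s := V) (t := (fun y ↦ A.evalEval y (g y)) ⁻¹' {0}ᶜ)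
    apply hmax _ ⟨_, hWV.trans hVU, hWo, ⟨y, hy, hAy⟩, rfl⟩
    refine lt_of_le_of_ne (graphIdeal_anti hWV) fun heq ↦ hB ?_
    rw [heq, mem_graphIdeal]
    intro t ht
    have := mem_graphIdeal.1 hAB t ht.1
    rw [evalEval_mul] at this
    exact (mul_eq_zero.1 this).resolve_left ht.2

theorem false_of_evalEval_graph_eq_zero {a₁ a₂ a₃ c : ℝ} (h₁ : 0 < a₁) (h₂ : 0 < a₂) (h₃ : 0 < a₃)
    (h : Irrational ((a₁ + a₃) / a₂)) {g g' : ℝ → ℝ} {U : Set ℝ} (hU : IsOpen U)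
    (hne : U.Nonempty) (hg : ∀ y ∈ U, HasDerivAt g (g' y) y) (hx : ∀ y ∈ U, g y ≠ 0)
    (hz : ∀ y ∈ U, c - y - g y ≠ 0)
    (hrel : ∀ y ∈ U, (a₁ * y * (c - y - g y) - a₃ * y * g y) * g' y +
      (a₂ * g y * (c - y - g y) - a₃ * y * g y) = 0)
    {P : ℝ[X][Y]} (hP : P ≠ 0) (hPg : ∀ y ∈ U, P.evalEval y (g y) = 0) : False := by
  obtain ⟨V, hVU, hVo, ⟨y₀, hy₀⟩, hI⟩ := exists_isOpen_isPrime_graphIdeal hU hne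
    fun y hy ↦ (hg y hy).continuousAt.continuousWithinAt
  refine false_of_isPrime h₁ h₂ h₃ (fun r hr ↦ h ⟨r, hr⟩) (c := c) hI ?_ (fun f hf ↦ ?_)
    (fun hX ↦ hx y₀ (hVU hy₀) (by simpa using mem_graphIdeal.1 hX y₀ hy₀))
    (fun hZ ↦ hz y₀ (hVU hy₀) (by simpa [evalEval_C] using mem_graphIdeal.1 hZ y₀ hy₀))
    fun G hG ↦ ?_
  · exact Submodule.ne_bot_iff _ |>.2 ⟨P, mem_graphIdeal.2 fun y hy ↦ hPg y (hVU hy), hP⟩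
  · refine eq_zero_of_infinite_isRoot f ((infinite_of_mem_nhds y₀ (hVo.mem_nhds hy₀)).mono ?_)
    intro y hy
    simpa [evalEval_C] using mem_graphIdeal.1 hf y hy
  · rw [mem_graphIdeal] at hG ⊢
    intro y hy
    have h0 : HasDerivAt (fun t ↦ G.evalEval t (g t)) 0 y := by
      refine (hasDerivAt_const y (0 : ℝ)).congr_of_eventuallyEq ?_
      filter_upwards [hVo.mem_nhds hy] with t ht using hG t ht
    have e := (hasDerivAt_evalEval (hg y (hVU hy)) G).unique h0
    simp only [evalEval_sub, evalEval_mul, evalEval_C, evalEval_X, eval_sub, eval_mul, eval_C,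
      eval_X]
    linear_combination (a₁ * y * (c - y - g y) - a₃ * y * g y) * e -
      (derivative G).evalEval y (g y) * hrel y (hVU hy)

end Polynomial

end Algebra

section Analysis

open Polynomial Bivariate Real Set Filter Topology

theorem lt_log_add_log_of_mem_Ioo {p q d x y z : ℝ} (hp : 0 < p) (hq : 0 ≤ q) (hx : 0 < x)
    (hz : z < d) (hxy : x < y) (hyz : y < z)
    (h : p * log x + q * log (d - x) = p * log z + q * log (d - z)) :
    p * log x + q * log (d - x) < p * log y + q * log (d - y) := by
  have hy : y ∈ openSegment ℝ x z := by
    rw [openSegment_eq_Ioo (hxy.trans hyz)]; exact ⟨hxy, hyz⟩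
  obtain ⟨a, b, ha, hb, hab, rfl⟩ := hy
  have h1 := strictConcaveOn_log_Ioi.2 (mem_Ioi.2 hx) (mem_Ioi.2 (hx.trans (hxy.trans hyz)))
    (hxy.trans hyz).ne ha hb hab
  have h2 := strictConcaveOn_log_Ioi.concaveOn.2
    (mem_Ioi.2 (sub_pos.2 ((hxy.trans hyz).trans hz))) (mem_Ioi.2 (sub_pos.2 hz)) ha.le hb.le hab
  simp only [smul_eq_mul] at *
  have h3 : a * (d - x) + b * (d - z) = d - (a * x + b * z) := by linear_combination d * hab
  rw [h3] at h2
  have h4 := mul_lt_mul_of_pos_left h1 hp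
  have h5 := mul_le_mul_of_nonneg_left h2 hq
  have h6 : p * log x + q * log (d - x) =
      p * (a * log x + b * log z) + q * (a * log (d - x) + b * log (d - z)) := by
    linear_combination b * h - (p * log x + q * log (d - x)) * hab
  linarith

theorem finite_setOf_log_add_log_eq {p q d K : ℝ} (hp : 0 < p) (hq : 0 ≤ q) :
    {t | 0 < t ∧ t < d ∧ p * log t + q * log (d - t) = K}.Finite := by
  set L := {t | 0 < t ∧ t < d ∧ p * log t + q * log (d - t) = K} with hL
  have key : ∀ x ∈ L, ∀ y ∈ L, ∀ z ∈ L, x < y → ¬ y < z := by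
    rintro x ⟨hx, -, hxK⟩ y ⟨-, -, hyK⟩ z ⟨-, hz, hzK⟩ hxy hyz
    have := lt_log_add_log_of_mem_Ioo hp hq hx hz hxy hyz (hxK.trans hzK.symm)
    linarith
  rcases L.eq_empty_or_nonempty with h | ⟨a, ha⟩
  · simp [h]
  have h1 : (L ∩ Ioi a).Subsingleton := fun x hx y hy ↦
    le_antisymm (not_lt.1 (key a ha y hy.1 x hx.1 hy.2)) (not_lt.1 (key a ha x hx.1 y hy.1 hx.2))
  have h2 : (L ∩ Iio a).Subsingleton := fun x hx y hy ↦
    le_antisymm (not_lt.1 fun h ↦ key y hy.1 x hx.1 a ha h hx.2)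
      (not_lt.1 fun h ↦ key x hx.1 y hy.1 a ha h hy.2)
  refine ((h1.finite.union h2.finite).union (finite_singleton a)).subset fun x hx ↦ ?_
  rcases lt_trichotomy x a with h | h | h
  · exact .inl (.inr ⟨hx, h⟩)
  · exact .inr h
  · exact .inl (.inl ⟨hx, h⟩)

theorem mul_rpow_mul_rpow_mul_rpow_eq_iff {a₁ a₂ a₃ β x y z : ℝ} (hβ : 0 < β) (hx : 0 < x)
    (hy : 0 < y) (hz : 0 < z) :
    x ^ a₁ * y ^ a₂ * z ^ a₃ = β ↔ a₁ * log x + a₂ * log y + a₃ * log z = log β := by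
  rw [← log_injOn_pos.eq_iff (mem_Ioi.2 (by positivity)) (mem_Ioi.2 hβ),
    log_mul (by positivity) (by positivity), log_mul (by positivity) (by positivity),
    log_rpow hx, log_rpow hy, log_rpow hz]

/-- An infinite level set of `x ^ a₁ * y ^ a₂ * (c - x - y) ^ a₃` contains a point where the
derivative in the direction of `x` does not vanish. -/
theorem exists_mul_ne_mul_of_infinite {a₁ a₂ a₃ β c : ℝ} (h₁ : 0 < a₁) (h₂ : 0 < a₂)
    (h₃ : 0 < a₃) (hβ : 0 < β)
    (hinf : {p : ℝ × ℝ | 0 < p.1 ∧ 0 < p.2 ∧ p.1 + p.2 < c ∧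
      p.1 ^ a₁ * p.2 ^ a₂ * (c - p.1 - p.2) ^ a₃ = β}.Infinite) :
    ∃ x y : ℝ, 0 < x ∧ 0 < y ∧ x + y < c ∧ x ^ a₁ * y ^ a₂ * (c - x - y) ^ a₃ = β ∧
      a₁ * (c - x - y) ≠ a₃ * x := by
  by_contra! H
  refine hinf (((finite_setOf_log_add_log_eq (q := a₁ + a₃) (d := c)
    (K := log β - a₁ * log (a₁ / (a₁ + a₃)) - a₃ * log (a₃ / (a₁ + a₃))) h₂
    (by positivity)).image fun y ↦ (a₁ / (a₁ + a₃) * (c - y), y)).subset ?_)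
  rintro ⟨x, y⟩ ⟨hx, hy, hxy, h⟩
  dsimp only at hx hy hxy h
  have e := H x y hx hy hxy h
  have hx' : x = a₁ / (a₁ + a₃) * (c - y) := by field_simp; linear_combination - e
  have hz' : c - x - y = a₃ / (a₁ + a₃) * (c - y) := by field_simp; linear_combination e
  have hcy : 0 < c - y := by linarith
  rw [mul_rpow_mul_rpow_mul_rpow_eq_iff hβ hx hy (by linarith), hz', hx',
    log_mul (by positivity) hcy.ne', log_mul (by positivity) hcy.ne'] at h
  exact ⟨y, ⟨hy, by linarith, by linear_combination h⟩, by simp [← hx']⟩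

theorem HasStrictDerivAt.exists_openPartialHomeomorph {u : ℝ → ℝ} {u' s : ℝ}
    (hu : HasStrictDerivAt u u' s) (h : u' ≠ 0) :
    ∃ e : OpenPartialHomeomorph ℝ ℝ, ⇑e = u ∧ s ∈ e.source :=
  ⟨(hu.hasStrictFDerivAt_equiv h).toOpenPartialHomeomorph u, rfl,
    (hu.hasStrictFDerivAt_equiv h).mem_toOpenPartialHomeomorph_source⟩

theorem hasStrictDerivAt_mul_log_add_mul_log {p q d t : ℝ} (ht : t ≠ 0) (hd : d - t ≠ 0) :
    HasStrictDerivAt (fun t ↦ p * log t + q * log (d - t)) (p / t - q / (d - t)) t := by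
  have h := ((hasStrictDerivAt_log ht).const_mul p).add
    ((((hasStrictDerivAt_id t).const_sub d).log hd).const_mul q)
  convert! h using 1
  simp; ring

/-- Near a point where the derivative in the direction of `x` does not vanish, a level set of
`x ^ a₁ * y ^ a₂ * (c - x - y) ^ a₃` is the graph of a function `x = g y`. -/
theorem exists_hasDerivAt_graph {a₁ a₂ a₃ β c x y : ℝ} (hβ : 0 < β) (hx : 0 < x) (hy : 0 < y)
    (hxy : x + y < c) (h : x ^ a₁ * y ^ a₂ * (c - x - y) ^ a₃ = β)
    (hne : a₁ * (c - x - y) ≠ a₃ * x) :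
    ∃ (g g' : ℝ → ℝ) (U : Set ℝ), IsOpen U ∧ U.Nonempty ∧ ∀ y ∈ U, HasDerivAt g (g' y) y ∧
      0 < g y ∧ 0 < y ∧ g y + y < c ∧ g y ^ a₁ * y ^ a₂ * (c - g y - y) ^ a₃ = β ∧
      (a₁ * y * (c - y - g y) - a₃ * y * g y) * g' y +
        (a₂ * g y * (c - y - g y) - a₃ * y * g y) = 0 := by
  have hcy : 0 < c - y := by linarith
  have hz : 0 < c - x - y := by linarith
  set s₀ := x / (c - y) with hs₀
  have hs₀0 : 0 < s₀ := by positivity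
  have hs₀1 : 1 - s₀ = (c - x - y) / (c - y) := by rw [hs₀]; field_simp; ring
  have hs₀1' : 0 < 1 - s₀ := by rw [hs₀1]; positivity
  have hder₀ : a₁ / s₀ - a₃ / (1 - s₀) ≠ 0 := by
    rw [hs₀1, hs₀]
    intro h0
    field_simp at h0
    rw [mul_zero] at h0
    exact hne (by linarith [(mul_eq_zero.1 h0).resolve_left hcy.ne'])
  obtain ⟨e, he, hse⟩ := (hasStrictDerivAt_mul_log_add_mul_log (p := a₁) (q := a₃) (d := 1)
    hs₀0.ne' hs₀1'.ne').exists_openPartialHomeomorph hder₀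
  have hu : ∀ t, e t = a₁ * log t + a₃ * log (1 - t) := fun t ↦ by rw [he]
  set w : ℝ → ℝ := fun t ↦ log β - (a₂ * log t + (a₁ + a₃) * log (c - t)) with hw
  have hw' : ∀ t, 0 < t → t < c → HasDerivAt w (-(a₂ / t - (a₁ + a₃) / (c - t))) t :=
    fun t h0 hc ↦ ((hasStrictDerivAt_mul_log_add_mul_log h0.ne' (sub_pos.2 hc).ne').hasDerivAt
      ).const_sub _
  have hwy : w y = e s₀ := by
    rw [mul_rpow_mul_rpow_mul_rpow_eq_iff hβ hx hy hz] at h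
    rw [hu, hs₀1, hs₀, log_div hx.ne' hcy.ne', log_div hz.ne' hcy.ne', hw]
    linear_combination -h
  have hwt : w y ∈ e.target := hwy ▸ e.map_source hse
  have hsy : e.symm (w y) = s₀ := by rw [hwy, e.left_inv hse]
  have hwc : ContinuousAt w y := (hw' y hy (by linarith)).continuousAt
  have hsc : ContinuousAt (fun t ↦ e.symm (w t)) y :=
    (e.continuousAt_symm hwt).comp hwc
  have hev : ∀ᶠ t in 𝓝 y, 0 < t ∧ t < c ∧ w t ∈ e.target ∧ 0 < e.symm (w t) ∧
      e.symm (w t) < 1 ∧ a₁ / e.symm (w t) - a₃ / (1 - e.symm (w t)) ≠ 0 := by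
    refine (eventually_gt_nhds hy).and ((eventually_lt_nhds (by linarith)).and
      ((hwc.eventually_mem (e.open_target.mem_nhds hwt)).and
      ((hsc.eventually_const_lt (by simpa only [hsy])).and
      ((hsc.eventually_lt_const (by simp only [hsy]; linarith)).and
      (ContinuousAt.eventually_ne ?_ (by simpa only [hsy]))))))
    exact (continuousAt_const.div hsc (by rw [hsy]; exact hs₀0.ne')).sub
      (continuousAt_const.div (continuousAt_const.sub hsc) (by rw [hsy]; exact hs₀1'.ne'))
  obtain ⟨U, hU, hUo, hyU⟩ := mem_nhds_iff.1 hev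
  refine ⟨fun t ↦ e.symm (w t) * (c - t), fun t ↦
    (a₁ / e.symm (w t) - a₃ / (1 - e.symm (w t)))⁻¹ * (-(a₂ / t - (a₁ + a₃) / (c - t))) * (c - t) +
      e.symm (w t) * -1, U, hUo, ⟨y, hyU⟩, fun t ht ↦ ?_⟩
  obtain ⟨ht0, htc, htt, hs0, hs1, hd⟩ := hU ht
  have hsd : HasDerivAt (fun t ↦ e.symm (w t))
      ((a₁ / e.symm (w t) - a₃ / (1 - e.symm (w t)))⁻¹ *
        (-(a₂ / t - (a₁ + a₃) / (c - t)))) t := by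
    refine HasDerivAt.comp t (e.hasDerivAt_symm htt hd ?_) (hw' t ht0 htc)
    rw [he]
    exact (hasStrictDerivAt_mul_log_add_mul_log hs0.ne' (by linarith)).hasDerivAt
  have hes := e.right_inv htt
  rw [hu] at hes
  beta_reduce
  refine ⟨hsd.mul ((hasDerivAt_id t).const_sub c), ?_⟩
  generalize e.symm (w t) = s at *
  have hct : 0 < c - t := by linarith
  have hs1' : 0 < 1 - s := by linarith
  have hz' : c - s * (c - t) - t = (1 - s) * (c - t) := by ring
  have hz0 : 0 < c - s * (c - t) - t := hz' ▸ by positivity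
  refine ⟨by positivity, ht0, by linarith, ?_, ?_⟩
  · rw [mul_rpow_mul_rpow_mul_rpow_eq_iff hβ (by positivity) ht0 hz0, hz',
      log_mul hs0.ne' hct.ne', log_mul hs1'.ne' hct.ne']
    rw [hw] at hes
    linear_combination hes
  · have hd' : a₁ * (1 - s) - s * a₃ ≠ 0 := by
      intro h0
      apply hd
      field_simp
      linarith
    have h2 : (a₁ / s - a₃ / (1 - s))⁻¹ = s * (1 - s) / (a₁ * (1 - s) - s * a₃) := by
      field_simp
    rw [h2]
    field_simp
    ring

theorem Polynomial.Bivariate.evalEval_swap_equivMvPolynomial_symm (P : MvPolynomial (Fin 2) ℝ)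
    (x y : ℝ) : (swap ((equivMvPolynomial ℝ).symm P)).evalEval y x =
      MvPolynomial.eval (fun i ↦ if i = 0 then x else y) P := by
  rw [← coe_aevalAeval_eq_evalEval, aevalAeval_swap]
  have : ((aevalAeval x y).comp (equivMvPolynomial ℝ).symm.toAlgHom) =
      MvPolynomial.aeval (fun i : Fin 2 ↦ if i = 0 then x else y) := by
    ext i; fin_cases i <;> simp
  exact DFunLike.congr_fun this P

end Analysis

/-- For `a₁, a₂, a₃ > 0` with `(a₁+a₃)/a₂` irrational and `β, c > 0`, no nonzero real
bivariate polynomial vanishes on the (infinite) real curve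
`{(λ₁,λ₂) | λ₁,λ₂ > 0, λ₁+λ₂ < c, λ₁^a₁ λ₂^a₂ (c-λ₁-λ₂)^a₃ = β}`. -/
theorem curve_not_algebraic (a₁ a₂ a₃ : ℝ) (h₁ : 0 < a₁) (h₂ : 0 < a₂) (h₃ : 0 < a₃)
    (hirr : Irrational ((a₁ + a₃) / a₂)) (β c : ℝ) (hβ : 0 < β) (hc : 0 < c)
    (hinf : {p : ℝ × ℝ | 0 < p.1 ∧ 0 < p.2 ∧ p.1 + p.2 < c ∧
      p.1 ^ a₁ * p.2 ^ a₂ * (c - p.1 - p.2) ^ a₃ = β}.Infinite) :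
    ¬ ∃ P : MvPolynomial (Fin 2) ℝ, P ≠ 0 ∧
      ∀ p ∈ {p : ℝ × ℝ | 0 < p.1 ∧ 0 < p.2 ∧ p.1 + p.2 < c ∧
        p.1 ^ a₁ * p.2 ^ a₂ * (c - p.1 - p.2) ^ a₃ = β},
        MvPolynomial.eval (fun i => if i = 0 then p.1 else p.2) P = 0 := by
  rintro ⟨P, hP, hPz⟩
  obtain ⟨x, y, hx, hy, hxy, h, hne⟩ := exists_mul_ne_mul_of_infinite h₁ h₂ h₃ hβ hinf
  obtain ⟨g, g', U, hUo, hU, hg⟩ := exists_hasDerivAt_graph hβ hx hy hxy h hne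
  refine Polynomial.false_of_evalEval_graph_eq_zero (c := c) h₁ h₂ h₃ hirr hUo hU
    (fun y hy ↦ (hg y hy).1) (fun y hy ↦ (hg y hy).2.1.ne') (fun y hy ↦ ?_)
    (fun y hy ↦ (hg y hy).2.2.2.2.2)
    (P := Polynomial.Bivariate.swap ((Polynomial.Bivariate.equivMvPolynomial ℝ).symm P))
    (by simpa using hP) (fun y hy ↦ ?_)
  · linarith [(hg y hy).2.2.2.1]
  · obtain ⟨-, h0, h0', hlt, heq, -⟩ := hg y hy
    rw [Polynomial.Bivariate.evalEval_swap_equivMvPolynomial_symm]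
    exact hPz (g y, y) ⟨h0, h0', hlt, heq⟩
end
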